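/- For every p with 1 ≤ p ≤ 2 there is a constant C (depending only on d, p, and β_0) such that for all k ∈ ℤ, all j ≥ 10, every interval I ⊆ [2^{k−1}, 2^{k+2}] of length 2^{k−j}, and every Schwartz function f on ℝ^d: ‖ sup_{t∈I} |A_t^j f| ‖_{L^p} ≤ C 2^{−j(d−1)/p'} ‖f‖_{L^p}, where p' = p/(p−1). -/

import Mathlib

open MeasureTheory Metric Set Filter
open scoped ENNReal NNReal Topology RealInnerProductSpace

noncomputable section

abbrev Ed (d : ℕ) := EuclideanSpace ℝ (Fin d)

/-- The rotation-invariant probability measure on the unit sphere. -/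
def sphereProb (d : ℕ) : Measure (sphere (0 : Ed d) 1) :=
  ((volume : Measure (Ed d)).toSphere Set.univ)⁻¹ • (volume : Measure (Ed d)).toSphere

def eChar (r : ℝ) : ℂ := Complex.exp ((r : ℂ) * Complex.I)

/-- The Fourier transform `\widehat{dσ}` of the sphere measure. -/
def sigmaHat (d : ℕ) (ξ : Ed d) : ℂ :=
  ∫ y : sphere (0 : Ed d) 1, eChar (-(2 * Real.pi * ⟪ξ, (y : Ed d)⟫)) ∂(sphereProb d)

/-- The Fourier transform `\hat f`. -/
def fourierInt (d : ℕ) (f : Ed d → ℂ) (ξ : Ed d) : ℂ :=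
  ∫ x : Ed d, eChar (-(2 * Real.pi * ⟪ξ, x⟫)) * f x

/-- `β₀ ∈ C_c^∞` is radial, `≡ 1` on `{|ξ| ≤ 1}` and `≡ 0` on `{|ξ| ≥ 2}`. -/
def IsAdmissibleBump (d : ℕ) (β0 : Ed d → ℝ) : Prop :=
  ContDiff ℝ (⊤ : ℕ∞) β0 ∧ HasCompactSupport β0 ∧
  (∀ ξ η : Ed d, ‖ξ‖ = ‖η‖ → β0 ξ = β0 η) ∧
  (∀ ξ : Ed d, ‖ξ‖ ≤ 1 → β0 ξ = 1) ∧ (∀ ξ : Ed d, 2 ≤ ‖ξ‖ → β0 ξ = 0)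

/-- `β_j(ξ) = β₀(2^{-j} ξ) - β₀(2^{1-j} ξ)`. -/
def betaJ (d : ℕ) (β0 : Ed d → ℝ) (j : ℕ) (ξ : Ed d) : ℝ :=
  β0 ((2:ℝ) ^ (-(j:ℤ)) • ξ) - β0 ((2:ℝ) ^ (1 - (j:ℤ)) • ξ)

/-- The frequency-localized spherical mean `A_t^j f`, defined via the Fourier
multiplier `\widehat{dσ}(tξ) β_j(tξ)`. -/
def Aj (d : ℕ) (β0 : Ed d → ℝ) (j : ℕ) (t : ℝ) (f : Ed d → ℂ) (x : Ed d) : ℂ :=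
  ∫ ξ : Ed d, eChar (2 * Real.pi * ⟪ξ, x⟫) *
    (sigmaHat d (t • ξ) * (betaJ d β0 j (t • ξ) : ℂ) * fourierInt d f ξ)

/-- `B_t^j f = (∂/∂t) A_t^j f`. -/
def Bj (d : ℕ) (β0 : Ed d → ℝ) (j : ℕ) (t : ℝ) (f : Ed d → ℂ) (x : Ed d) : ℂ :=
  deriv (fun s : ℝ => Aj d β0 j s f x) t

/-- `sup_{t ∈ S} |A_t^j f(x)|`, valued in `ℝ≥0∞`. -/
def supAj (d : ℕ) (β0 : Ed d → ℝ) (j : ℕ) (S : Set ℝ) (f : Ed d → ℂ) (x : Ed d) : ℝ≥0∞ :=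
  ⨆ t ∈ S, (‖Aj d β0 j t f x‖₊ : ℝ≥0∞)

open FourierTransform SchwartzMap in
theorem fourier_ae_eq_toLp {d : ℕ} {g : Ed d → ℂ} (hg1 : Integrable g) (hg2 : MemLp g 2) :
    (𝓕 g : Ed d → ℂ) =ᵐ[volume] (𝓕 hg2.toLp : Lp ℂ 2 (volume : Measure (Ed d))) := by
  have hcont : Continuous (𝓕 g : Ed d → ℂ) :=
    VectorFourier.fourierIntegral_continuous Real.continuous_fourierChar
      (by exact continuous_inner) hg1
  refine ae_eq_of_integral_contDiff_smul_eq hcont.locallyIntegrable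
    ((Lp.memLp (𝓕 hg2.toLp)).locallyIntegrable (by norm_num)) fun φ hφ hφc => ?_
  have hφ1 : HasCompactSupport (fun x => (φ x : ℂ)) := hφc.comp_left Complex.ofReal_zero
  have hφ2 : ContDiff ℝ (⊤ : ℕ∞) (fun x => (φ x : ℂ)) := Complex.ofRealCLM.contDiff.comp hφ
  set Φ : 𝓢(Ed d, ℂ) := hφ1.toSchwartzMap hφ2 with hΦ
  have h := congrArg (fun T : 𝓢'(Ed d, ℂ) => T Φ)
    (Lp.fourier_toTemperedDistribution_eq hg2.toLp)
  simp only [TemperedDistribution.fourier_apply, Lp.toTemperedDistribution_apply] at h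
  have hΦ' : ∀ x, Φ x = (φ x : ℂ) := fun x => rfl
  simp only [hΦ', smul_eq_mul] at h
  simp only [Complex.real_smul]
  rw [← h]
  have h3 := VectorFourier.integral_fourierIntegral_smul_eq_flip (L := innerₗ (Ed d))
    (μ := volume) (ν := volume) Real.continuous_fourierChar
    (by exact continuous_inner) (Φ.integrable) hg1
  simp only [smul_eq_mul, flip_innerₗ] at h3
  calc _ = ∫ x, (𝓕 g : Ed d → ℂ) x * Φ x := by simp only [hΦ', mul_comm]
    _ = ∫ x, Φ x * (𝓕 g : Ed d → ℂ) x := by simp only [mul_comm]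
    _ = ∫ x, (𝓕 (⇑Φ) : Ed d → ℂ) x * g x := h3.symm
    _ = _ := by
      refine integral_congr_ae ?_
      filter_upwards [hg2.coeFn_toLp] with x hx
      rw [hx]; rfl

theorem eLpNorm_two_sq {d : ℕ} (g : Ed d → ℂ) : eLpNorm g 2 volume ^ 2 = ∫⁻ x, ‖g x‖ₑ ^ 2 := by
  rw [eLpNorm_eq_lintegral_rpow_enorm_toReal (by norm_num) (by norm_num), ← ENNReal.rpow_natCast,
    ← ENNReal.rpow_mul]
  simp

theorem fourierInt_eq {d : ℕ} (g : Ed d → ℂ) : fourierInt d g = FourierTransform.fourier g := by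
  ext ξ
  rw [Real.fourier_eq', fourierInt]
  refine integral_congr_ae (.of_forall fun x => ?_)
  simp only [eChar, smul_eq_mul]
  rw [real_inner_comm]
  push_cast
  ring_nf

theorem lintegral_fourierInt_sq {d : ℕ} {g : Ed d → ℂ} (hg1 : Integrable g) (hg2 : MemLp g 2) :
    ∫⁻ ξ, ‖fourierInt d g ξ‖ₑ ^ 2 = ∫⁻ x, ‖g x‖ₑ ^ 2 := by
  rw [← eLpNorm_two_sq, ← eLpNorm_two_sq, fourierInt_eq,
    eLpNorm_congr_ae (fourier_ae_eq_toLp hg1 hg2)]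
  have h := Lp.norm_fourier_eq hg2.toLp
  rw [Lp.norm_def, Lp.norm_def, ENNReal.toReal_eq_toReal_iff' (Lp.eLpNorm_ne_top _)
    (Lp.eLpNorm_ne_top _)] at h
  rw [h, eLpNorm_congr_ae hg2.coeFn_toLp]

theorem memLp_fourierInt {d : ℕ} {g : Ed d → ℂ} (hg1 : Integrable g) (hg2 : MemLp g 2) :
    MemLp (fourierInt d g) 2 := by
  rw [fourierInt_eq]
  exact (memLp_congr_ae (fourier_ae_eq_toLp hg1 hg2)).2 (Lp.memLp _)

theorem continuous_fourierInt {d : ℕ} {g : Ed d → ℂ} (hg1 : Integrable g) :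
    Continuous (fourierInt d g) := by
  rw [fourierInt_eq]
  exact VectorFourier.fourierIntegral_continuous Real.continuous_fourierChar
      (by exact continuous_inner) hg1

theorem norm_eChar (r : ℝ) : ‖eChar r‖ = 1 := Complex.norm_exp_ofReal_mul_I r

@[fun_prop]
theorem continuous_eChar : Continuous eChar := by unfold eChar; fun_prop

theorem eChar_add (r s : ℝ) : eChar (r + s) = eChar r * eChar s := by
  simp only [eChar]; rw [← Complex.exp_add]; push_cast; ring_nf

theorem norm_fourierInt_le {d : ℕ} (g : Ed d → ℂ) (ξ : Ed d) :
    ‖fourierInt d g ξ‖ ≤ ∫ x, ‖g x‖ := by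
  refine (norm_integral_le_integral_norm _).trans_eq ?_
  simp [norm_eChar]

/-- Plancherel for the inverse Fourier integral. -/
theorem lintegral_fourierIntInv_sq {d : ℕ} {g : Ed d → ℂ} (hg1 : Integrable g) (hg2 : MemLp g 2) :
    ∫⁻ x, ‖∫ ξ : Ed d, eChar (2 * Real.pi * ⟪ξ, x⟫) * g ξ‖ₑ ^ 2 = ∫⁻ ξ, ‖g ξ‖ₑ ^ 2 := by
  rw [← lintegral_fourierInt_sq hg1 hg2, ← lintegral_neg_eq_self]
  simp only [fourierInt, inner_neg_right, mul_neg]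
  refine lintegral_congr fun x => ?_
  simp only [real_inner_comm]

/-- The action of a linear isometry on the unit sphere. -/
def sphereMap {d : ℕ} (L : Ed d ≃ₗᵢ[ℝ] Ed d) (y : sphere (0 : Ed d) 1) : sphere (0 : Ed d) 1 :=
  ⟨L y, by simp⟩

theorem continuous_sphereMap {d : ℕ} (L : Ed d ≃ₗᵢ[ℝ] Ed d) : Continuous (sphereMap L) := by
  unfold sphereMap
  exact Continuous.subtype_mk (L.continuous.comp continuous_subtype_val) _

theorem map_sphereMap {d : ℕ} (L : Ed d ≃ₗᵢ[ℝ] Ed d) :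
    ((volume : Measure (Ed d)).toSphere).map (sphereMap L) =
      (volume : Measure (Ed d)).toSphere := by
  ext s hs
  have hm := (continuous_sphereMap L).measurable
  rw [Measure.map_apply hm hs, Measure.toSphere_apply' _ (hm hs), Measure.toSphere_apply' _ hs]
  congr 1
  conv_rhs => rw [← L.measurePreserving.measure_preimage_emb L.toHomeomorph.measurableEmbedding]
  congr 1
  ext x
  simp only [Set.mem_smul, Set.mem_image, Set.mem_preimage, Subtype.exists]
  constructor
  · rintro ⟨r, hr, _, ⟨z, hz, hzs, rfl⟩, rfl⟩
    exact ⟨r, hr, L z, ⟨L z, by simpa using hz, hzs, rfl⟩, by simp⟩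
  · rintro ⟨r, hr, _, ⟨z, hz, hzs, rfl⟩, hx⟩
    refine ⟨r, hr, L.symm z, ⟨L.symm z, by simpa using hz, ?_, rfl⟩, ?_⟩
    · simpa [sphereMap] using hzs
    · apply L.injective
      simpa using hx

theorem sphereProb_univ_le (d : ℕ) : sphereProb d univ ≤ 1 := by
  simp only [sphereProb, Measure.smul_apply, smul_eq_mul]
  exact ENNReal.inv_mul_le_one _

instance (d : ℕ) : IsFiniteMeasure (sphereProb d) :=
  ⟨(sphereProb_univ_le d).trans_lt ENNReal.one_lt_top⟩

theorem sphereProb_real_univ_le (d : ℕ) : (sphereProb d).real univ ≤ 1 :=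
  ENNReal.toReal_le_of_le_ofReal zero_le_one (by simpa using sphereProb_univ_le d)

theorem integral_sphere_isometry {d : ℕ} (L : Ed d ≃ₗᵢ[ℝ] Ed d) {h : Ed d → ℝ}
    (hh : Continuous h) :
    ∫ y : sphere (0 : Ed d) 1, h (L y) ∂(sphereProb d) =
      ∫ y : sphere (0 : Ed d) 1, h y ∂(sphereProb d) := by
  have : (sphereProb d).map (sphereMap L) = sphereProb d := by
    rw [sphereProb, Measure.map_smul, map_sphereMap]
  conv_rhs => rw [← this]
  rw [integral_map (continuous_sphereMap L).measurable.aemeasurable]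
  · rfl
  · exact (hh.comp continuous_subtype_val).aestronglyMeasurable

theorem norm_integral_sphere_le {d : ℕ} {E : Type*} [NormedAddCommGroup E] [NormedSpace ℝ E]
    {h : sphere (0 : Ed d) 1 → E} {C : ℝ} (hC : 0 ≤ C) (hb : ∀ y, ‖h y‖ ≤ C) :
    ‖∫ y, h y ∂(sphereProb d)‖ ≤ C := by
  refine (norm_integral_le_of_norm_le_const (.of_forall hb)).trans ?_
  exact mul_le_of_le_one_right hC (sphereProb_real_univ_le d)

theorem integrable_sphere {d : ℕ} {E : Type*} [NormedAddCommGroup E]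
    {h : sphere (0 : Ed d) 1 → E} (hh : Continuous h) : Integrable h (sphereProb d) := by
  obtain ⟨C, hC⟩ := isCompact_univ.exists_bound_of_continuousOn hh.continuousOn
  exact Integrable.of_bound hh.aestronglyMeasurable C (.of_forall fun y => hC y (mem_univ y))

theorem abs_inner_sphere_le {d : ℕ} (ξ : Ed d) (y : sphere (0 : Ed d) 1) :
    |⟪ξ, (y : Ed d)⟫| ≤ ‖ξ‖ := by
  simpa using abs_real_inner_le_norm ξ (y : Ed d)

/-- Differentiation of smooth functions of a parameter under the sphere integral. -/
theorem hasDerivAt_integral_sphere {d : ℕ} {E : Type*} [NormedAddCommGroup E] [NormedSpace ℝ E]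
    {F F' : ℝ → sphere (0 : Ed d) 1 → E} (hF : ∀ t, Continuous (F t))
    (hF' : Continuous (fun q : ℝ × sphere (0 : Ed d) 1 => F' q.1 q.2))
    (hd : ∀ t y, HasDerivAt (fun s => F s y) (F' t y) t) (t₀ : ℝ) :
    HasDerivAt (fun t => ∫ y, F t y ∂(sphereProb d)) (∫ y, F' t₀ y ∂(sphereProb d)) t₀ := by
  obtain ⟨C, hC⟩ := ((isCompact_closedBall t₀ 1).prod
    (isCompact_univ (X := sphere (0 : Ed d) 1))).exists_bound_of_continuousOn hF'.continuousOn
  refine (hasDerivAt_integral_of_dominated_loc_of_deriv_le (bound := fun _ => C)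
    (ball_mem_nhds t₀ one_pos)
    (.of_forall fun t => (hF t).aestronglyMeasurable) (integrable_sphere (hF t₀)) ?_ ?_
    (integrable_const C) ?_).2
  · exact (hF'.comp (by fun_prop : Continuous fun y => (t₀, y))).aestronglyMeasurable
  · exact .of_forall fun y t ht => hC (t, y) ⟨ball_subset_closedBall ht, mem_univ _⟩
  · exact .of_forall fun y t _ => hd t y

/-- The infinitesimal rotation identity in the plane spanned by orthonormal vectors `e, f`. -/
theorem sphere_rotation_identity {d : ℕ} {e f : Ed d} (he : ‖e‖ = 1) (hf : ‖f‖ = 1)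
    (hef : ⟪e, f⟫ = 0) (r φ : ℝ) :
    ∫ y : sphere (0 : Ed d) 1, (⟪e, (y : Ed d)⟫ * Real.cos (r * ⟪e, (y : Ed d)⟫ + φ) +
      r * ⟪f, (y : Ed d)⟫ ^ 2 * Real.sin (r * ⟪e, (y : Ed d)⟫ + φ)) ∂(sphereProb d) = 0 := by
  let h : Ed d → ℝ := fun y => ⟪f, y⟫ * Real.cos (r * ⟪e, y⟫ + φ)
  have hh : Continuous h := by fun_prop
  let n : ℝ → Ed d := fun θ => Real.cos θ • f + Real.sin θ • e
  have hn : ∀ θ, ‖n θ‖ = 1 := fun θ => by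
    have : ‖n θ‖ ^ 2 = 1 := by
      rw [← real_inner_self_eq_norm_sq]
      simp only [n, inner_add_left, inner_add_right, inner_smul_left, inner_smul_right,
        real_inner_self_eq_norm_sq, he, hf, hef, real_inner_comm e f]
      simp
      nlinarith [Real.sin_sq_add_cos_sq θ]
    nlinarith [norm_nonneg (n θ)]
  let F : ℝ → sphere (0 : Ed d) 1 → ℝ := fun θ y =>
    (-(Real.sin (2 * θ)) * ⟪e, (y : Ed d)⟫ - Real.cos (2 * θ) * ⟪f, (y : Ed d)⟫) *
      Real.cos (r * (Real.cos (2 * θ) * ⟪e, (y : Ed d)⟫ - Real.sin (2 * θ) * ⟪f, (y : Ed d)⟫) + φ)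
  let F' : ℝ → sphere (0 : Ed d) 1 → ℝ := fun θ y =>
    (-(2 * Real.cos (2 * θ)) * ⟪e, (y : Ed d)⟫ + 2 * Real.sin (2 * θ) * ⟪f, (y : Ed d)⟫) *
      Real.cos (r * (Real.cos (2 * θ) * ⟪e, (y : Ed d)⟫ - Real.sin (2 * θ) * ⟪f, (y : Ed d)⟫) + φ)
    + (-(Real.sin (2 * θ)) * ⟪e, (y : Ed d)⟫ - Real.cos (2 * θ) * ⟪f, (y : Ed d)⟫) *
      (-Real.sin (r * (Real.cos (2 * θ) * ⟪e, (y : Ed d)⟫ - Real.sin (2 * θ) * ⟪f, (y : Ed d)⟫)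
        + φ) * (r * (-(2 * Real.sin (2 * θ)) * ⟪e, (y : Ed d)⟫ -
          2 * Real.cos (2 * θ) * ⟪f, (y : Ed d)⟫)))
  have hconst : ∀ θ, ∫ y, F θ y ∂(sphereProb d) = ∫ y : sphere (0 : Ed d) 1, h y ∂(sphereProb d) := by
    intro θ
    rw [← integral_sphere_isometry ((ℝ ∙ (n θ))ᗮ.reflection) hh]
    refine integral_congr_ae (.of_forall fun y => ?_)
    have hr : (ℝ ∙ (n θ))ᗮ.reflection (y : Ed d) = y - (2 * ⟪n θ, (y : Ed d)⟫) • n θ := by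
      rw [Submodule.reflection_orthogonal_apply, Submodule.reflection_singleton_apply, hn]
      simp [two_mul, add_smul, two_nsmul]
    simp only [h, F, hr, n, inner_sub_right, inner_smul_right, inner_add_right, inner_add_left,
      inner_smul_left, real_inner_self_eq_norm_sq, he, hf, hef, real_inner_comm e f]
    simp only [Real.sin_two_mul, Real.cos_two_mul]
    have hs := Real.sin_sq_add_cos_sq θ
    congr 1
    · simp; ring
    · congr 3
      simp
      linear_combination (2 * ⟪e, (y : Ed d)⟫) * hs
  have hder := hasDerivAt_integral_sphere (d := d) (F := F) (F' := F') (fun t => by fun_prop)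
    (by fun_prop) (fun t y => by
      have h2 : HasDerivAt (fun s : ℝ => 2 * s) 2 t := by
        simpa using (hasDerivAt_id t).const_mul 2
      have hsin := h2.sin
      have hcos := h2.cos
      convert! ((hsin.neg.mul_const ⟪e, (y : Ed d)⟫).sub (hcos.mul_const ⟪f, (y : Ed d)⟫)).mul
        ((((hcos.mul_const ⟪e, (y : Ed d)⟫).sub
          (hsin.mul_const ⟪f, (y : Ed d)⟫)).const_mul r).add_const φ).cos using 1
      simp only [F']
      simp
      ring_nf) 0
  simp only [hconst] at hder
  have h0 := hder.unique (hasDerivAt_const _ _)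
  have : ∀ y, F' 0 y = -2 * (⟪e, (y : Ed d)⟫ * Real.cos (r * ⟪e, (y : Ed d)⟫ + φ) +
      r * ⟪f, (y : Ed d)⟫ ^ 2 * Real.sin (r * ⟪e, (y : Ed d)⟫ + φ)) := fun y => by
    simp [F']; ring
  simp only [this, integral_const_mul] at h0
  linarith

/-- Decay of bounded solutions of the Bessel-type equation
`r (u'' + κ u) + n u' = 0`, by an energy estimate. -/
theorem bessel_energy_bound {m : ℕ} {κ : ℝ} (hκ : 1 ≤ κ) {u u₁ u₂ : ℝ → ℝ}
    (h1 : ∀ r, HasDerivAt u (u₁ r) r) (h2 : ∀ r, HasDerivAt u₁ (u₂ r) r)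
    (hode : ∀ r, r * (u₂ r + κ * u r) + (m + 1) * u₁ r = 0)
    (hw : ∀ r, u₁ r ^ 2 + κ * u r ^ 2 ≤ 2 * κ) {r : ℝ} (hr : 0 ≤ r) :
    r ^ (m + 1) * (u₁ r ^ 2 + κ * u r ^ 2) ≤ 3 * Real.exp 1 * (m + 1) ^ (m + 1) * (2 * κ) := by
  set n : ℝ := (m : ℝ) + 1 with hn
  have hn0 : 0 < n := by positivity
  have hexp : 1 ≤ Real.exp 1 := Real.one_le_exp zero_le_one
  have huu : ∀ r, 2 * |u r * u₁ r| ≤ u₁ r ^ 2 + κ * u r ^ 2 := fun r => by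
    rw [abs_mul]
    nlinarith [sq_nonneg (|u r| - |u₁ r|), sq_abs (u r), sq_abs (u₁ r), sq_nonneg (u r)]
  have hwnn : ∀ r, 0 ≤ u₁ r ^ 2 + κ * u r ^ 2 := fun r => by positivity
  rcases le_total r n with hrn | hrn
  · calc r ^ (m + 1) * (u₁ r ^ 2 + κ * u r ^ 2) ≤ n ^ (m + 1) * (2 * κ) := by
          gcongr
          exact hw r
      _ ≤ 3 * Real.exp 1 * (n ^ (m + 1) * (2 * κ)) :=
          le_mul_of_one_le_left (by positivity) (by linarith)
      _ = _ := by ring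
  let G : ℝ → ℝ := fun r => r ^ (m + 1) * (u₁ r ^ 2 + κ * u r ^ 2) + n * r ^ m * (u r * u₁ r)
  have hG : ∀ s, 0 < s → HasDerivAt G (-n * s ^ m * (u s * u₁ s) / s) s := fun s hs => by
    have hd := (((hasDerivAt_pow (m + 1) s).mul
      (((h2 s).pow 2).add (((h1 s).pow 2).const_mul κ))).add
        (((hasDerivAt_pow m s).const_mul n).mul ((h1 s).mul (h2 s))))
    have hu2 : u₂ s = -κ * u s - n * u₁ s / s := by
      field_simp
      linarith [hode s]
    convert! hd using 1
    rw [hu2]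
    rcases m with _ | k
    · simp [hn]
      field_simp
      ring
    · simp [hn]
      field_simp
      ring
  have hGlow : ∀ s, n ≤ s → s ^ (m + 1) * (u₁ s ^ 2 + κ * u s ^ 2) ≤ 2 * G s := fun s hs => by
    have hs0 : 0 ≤ s := hn0.le.trans hs
    have h3 : n * s ^ m * (u s * u₁ s) ≥ -(s ^ (m + 1) * |u s * u₁ s|) := by
      have : |n * s ^ m * (u s * u₁ s)| ≤ s ^ (m + 1) * |u s * u₁ s| := by
        rw [abs_mul, abs_of_nonneg (by positivity : 0 ≤ n * s ^ m), pow_succ']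
        gcongr
      linarith [neg_abs_le (n * s ^ m * (u s * u₁ s))]
    have h4 := mul_le_mul_of_nonneg_left (huu s) (pow_nonneg hs0 (m + 1))
    simp only [G]
    linarith
  have hanti : AntitoneOn (fun s => G s * Real.exp (n / s)) (Ici n) := by
    have hder : ∀ s, 0 < s → HasDerivAt (fun s => G s * Real.exp (n / s))
        ((-n * s ^ m * (u s * u₁ s) / s) * Real.exp (n / s) +
          G s * (Real.exp (n / s) * (-n / s ^ 2))) s := fun s hs => by
      refine (hG s hs).mul ?_
      have := ((hasDerivAt_inv hs.ne').const_mul n).exp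
      simpa [div_eq_mul_inv] using! this
    refine antitoneOn_of_deriv_nonpos (convex_Ici n) (fun s hs =>
      (hder s (hn0.trans_le hs)).continuousAt.continuousWithinAt) (fun s hs => ?_) fun s hs => ?_
    · rw [interior_Ici] at hs
      exact (hder s (hn0.trans hs)).differentiableAt.differentiableWithinAt
    · rw [interior_Ici] at hs
      have hs0 : 0 < s := hn0.trans hs
      rw [(hder s hs0).deriv]
      have hkey : -(s ^ (m + 1) * (u s * u₁ s)) - G s ≤ 0 := by
        have ha : -(s ^ (m + 1) * (u s * u₁ s)) ≤ s ^ (m + 1) * |u s * u₁ s| := by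
          rw [← mul_neg]; gcongr; exact neg_le_abs _
        have hb : -(n * s ^ m * (u s * u₁ s)) ≤ s ^ (m + 1) * |u s * u₁ s| := by
          rw [← mul_neg, pow_succ']
          refine (mul_le_mul_of_nonneg_left (neg_le_abs _) (by positivity)).trans ?_
          gcongr
          exact le_of_lt hs
        have h4 := mul_le_mul_of_nonneg_left (huu s) (pow_nonneg hs0.le (m + 1))
        simp only [G]
        linarith
      have : (-n * s ^ m * (u s * u₁ s) / s) * Real.exp (n / s) +
          G s * (Real.exp (n / s) * (-n / s ^ 2)) =
          (-(s ^ (m + 1) * (u s * u₁ s)) - G s) * (n * Real.exp (n / s) / s ^ 2) := by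
        field_simp
        ring
      rw [this]
      exact mul_nonpos_of_nonpos_of_nonneg hkey (by positivity)
  have hle := hanti (mem_Ici.2 le_rfl) (mem_Ici.2 hrn) hrn
  simp only [div_self hn0.ne'] at hle
  have hr0 : 0 < r := hn0.trans_le hrn
  have hGr : 0 ≤ G r := by
    have := hGlow r hrn
    have := mul_nonneg (pow_nonneg hr (m + 1)) (hwnn r)
    linarith
  have hGn : G n ≤ 3 / 2 * n ^ (m + 1) * (2 * κ) := by
    have hb : n * n ^ m * (u n * u₁ n) ≤ n ^ (m + 1) * |u n * u₁ n| := by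
      rw [pow_succ']; gcongr; exact le_abs_self _
    have h4 := mul_le_mul_of_nonneg_left (huu n) (pow_nonneg hn0.le (m + 1))
    have h5 := mul_le_mul_of_nonneg_left (hw n) (pow_nonneg hn0.le (m + 1))
    simp only [G]
    linarith
  calc _ ≤ 2 * G r := hGlow r hrn
    _ ≤ 2 * (G r * Real.exp (n / r)) := by
        gcongr
        exact le_mul_of_one_le_right hGr (Real.one_le_exp (by positivity))
    _ ≤ 2 * (G n * Real.exp 1) := by gcongr
    _ ≤ 2 * ((3 / 2 * n ^ (m + 1) * (2 * κ)) * Real.exp 1) := by gcongr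
    _ = _ := by ring

/-- The cosine transform of the sphere measure in direction `e`, with phase `φ`. -/
def sphereCos {d : ℕ} (e : Ed d) (φ r : ℝ) : ℝ :=
  ∫ y : sphere (0 : Ed d) 1, Real.cos (2 * Real.pi * r * ⟪e, (y : Ed d)⟫ + φ) ∂(sphereProb d)

/-- The derivative of `sphereCos`. -/
def sphereCosDeriv {d : ℕ} (e : Ed d) (φ r : ℝ) : ℝ :=
  ∫ y : sphere (0 : Ed d) 1, -(2 * Real.pi * ⟪e, (y : Ed d)⟫) *
    Real.sin (2 * Real.pi * r * ⟪e, (y : Ed d)⟫ + φ) ∂(sphereProb d)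

/-- The second derivative of `sphereCos`. -/
def sphereCosDeriv2 {d : ℕ} (e : Ed d) (φ r : ℝ) : ℝ :=
  ∫ y : sphere (0 : Ed d) 1, -(2 * Real.pi * ⟪e, (y : Ed d)⟫) ^ 2 *
    Real.cos (2 * Real.pi * r * ⟪e, (y : Ed d)⟫ + φ) ∂(sphereProb d)

theorem hasDerivAt_sphereCos {d : ℕ} (e : Ed d) (φ r : ℝ) :
    HasDerivAt (sphereCos e φ) (sphereCosDeriv e φ r) r := by
  refine hasDerivAt_integral_sphere (d := d)
    (F := fun r y => Real.cos (2 * Real.pi * r * ⟪e, (y : Ed d)⟫ + φ))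
    (F' := fun r y => -(2 * Real.pi * ⟪e, (y : Ed d)⟫) *
      Real.sin (2 * Real.pi * r * ⟪e, (y : Ed d)⟫ + φ)) (fun t => ?_) ?_ (fun t y => ?_) r
  · fun_prop
  · fun_prop
  have : HasDerivAt (fun s : ℝ => 2 * Real.pi * s * ⟪e, (y : Ed d)⟫ + φ)
      (2 * Real.pi * ⟪e, (y : Ed d)⟫) t := by
    simpa using (((hasDerivAt_id t).const_mul (2 * Real.pi)).mul_const ⟪e, (y : Ed d)⟫).add_const φ
  convert! this.cos using 1
  ring

theorem hasDerivAt_sphereCosDeriv {d : ℕ} (e : Ed d) (φ r : ℝ) :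
    HasDerivAt (sphereCosDeriv e φ) (sphereCosDeriv2 e φ r) r := by
  refine hasDerivAt_integral_sphere (d := d)
    (F := fun r y => -(2 * Real.pi * ⟪e, (y : Ed d)⟫) *
      Real.sin (2 * Real.pi * r * ⟪e, (y : Ed d)⟫ + φ))
    (F' := fun r y => -(2 * Real.pi * ⟪e, (y : Ed d)⟫) ^ 2 *
      Real.cos (2 * Real.pi * r * ⟪e, (y : Ed d)⟫ + φ)) (fun t => ?_) ?_ (fun t y => ?_) r
  · fun_prop
  · fun_prop
  have : HasDerivAt (fun s : ℝ => 2 * Real.pi * s * ⟪e, (y : Ed d)⟫ + φ)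
      (2 * Real.pi * ⟪e, (y : Ed d)⟫) t := by
    simpa using (((hasDerivAt_id t).const_mul (2 * Real.pi)).mul_const ⟪e, (y : Ed d)⟫).add_const φ
  convert! this.sin.const_mul (-(2 * Real.pi * ⟪e, (y : Ed d)⟫)) using 1
  ring

theorem sphereCos_ode {m : ℕ} {e : Ed (m + 2)} (he : ‖e‖ = 1) (φ r : ℝ) :
    r * (sphereCosDeriv2 e φ r + (4 * Real.pi ^ 2) * sphereCos e φ r) +
      (m + 1) * sphereCosDeriv e φ r = 0 := by
  obtain ⟨b, hb⟩ : ∃ b : OrthonormalBasis (Fin (m + 2)) ℝ (Ed (m + 2)), b 0 = e := by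
    obtain ⟨b, hb⟩ := Orthonormal.exists_orthonormalBasis_extension_of_card_eq (𝕜 := ℝ)
      (ι := Fin (m + 2)) (E := Ed (m + 2)) (by simp) (v := fun _ => e) (s := {0})
      (by
        refine ⟨fun i => by simpa using he, fun i j hij => ?_⟩
        exact absurd (Subsingleton.elim i j) hij)
    exact ⟨b, hb 0 rfl⟩
  have hrot : ∀ i : Fin (m + 1), ∫ y : sphere (0 : Ed (m + 2)) 1, (⟪e, (y : Ed _)⟫ *
      Real.sin (2 * Real.pi * r * ⟪e, (y : Ed _)⟫ + φ) - 2 * Real.pi * r *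
        ⟪b i.succ, (y : Ed _)⟫ ^ 2 * Real.cos (2 * Real.pi * r * ⟪e, (y : Ed _)⟫ + φ))
        ∂(sphereProb (m + 2)) = 0 := fun i => by
    have h := sphere_rotation_identity he (b.norm_eq_one i.succ)
      (by rw [← hb]; exact b.inner_eq_zero (Fin.succ_ne_zero i).symm) (2 * Real.pi * r)
      (φ - Real.pi / 2)
    rw [← h]
    refine integral_congr_ae (.of_forall fun y => ?_)
    simp only [← add_sub_assoc, Real.cos_sub_pi_div_two, Real.sin_sub_pi_div_two]
    ring
  have hsum := Finset.sum_eq_zero fun i (_ : i ∈ Finset.univ) => hrot i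
  rw [← integral_finsetSum _ fun i _ => integrable_sphere (by fun_prop)] at hsum
  have hsq : ∀ y : sphere (0 : Ed (m + 2)) 1,
      ∑ i : Fin (m + 1), ⟪b i.succ, (y : Ed _)⟫ ^ 2 = 1 - ⟪e, (y : Ed _)⟫ ^ 2 := fun y => by
    have := b.sum_sq_inner_right (y : Ed _)
    rw [Fin.sum_univ_succ, hb] at this
    simp at this
    linarith
  rw [sphereCosDeriv2, sphereCos, sphereCosDeriv, ← integral_const_mul, ← integral_add
    (integrable_sphere (by fun_prop)) (integrable_sphere (by fun_prop)),
    ← integral_const_mul, ← integral_const_mul, ← integral_add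
    (integrable_sphere (by fun_prop)) (integrable_sphere (by fun_prop))]
  rw [show (0 : ℝ) = -(2 * Real.pi) * 0 by simp, ← hsum, ← integral_const_mul]
  refine integral_congr_ae (.of_forall fun y => ?_)
  simp only [Finset.sum_sub_distrib, ← Finset.sum_mul, ← Finset.mul_sum, hsq]
  simp
  ring

theorem sphereCos_decay {m : ℕ} {e : Ed (m + 2)} (he : ‖e‖ = 1) (φ : ℝ) {r : ℝ} (hr : 0 ≤ r) :
    r ^ (m + 1) * (sphereCosDeriv e φ r ^ 2 + (4 * Real.pi ^ 2) * sphereCos e φ r ^ 2) ≤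
      3 * Real.exp 1 * (m + 1) ^ (m + 1) * (2 * (4 * Real.pi ^ 2)) := by
  have hpi := Real.pi_gt_three
  refine bessel_energy_bound (by nlinarith) (hasDerivAt_sphereCos e φ)
    (hasDerivAt_sphereCosDeriv e φ) (sphereCos_ode he φ) (fun r => ?_) hr
  have h1 : |sphereCos e φ r| ≤ 1 := by
    rw [sphereCos, ← Real.norm_eq_abs]
    exact norm_integral_sphere_le zero_le_one fun y => Real.abs_cos_le_one _
  have h2 : |sphereCosDeriv e φ r| ≤ 2 * Real.pi := by
    rw [sphereCosDeriv, ← Real.norm_eq_abs]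
    refine norm_integral_sphere_le (by positivity) fun y => ?_
    have := abs_inner_sphere_le e y
    rw [he] at this
    rw [Real.norm_eq_abs, abs_mul, abs_neg, abs_mul, abs_of_pos (by positivity : 0 < 2 * Real.pi)]
    calc _ ≤ 2 * Real.pi * 1 * 1 := by
          gcongr
          exact Real.abs_sin_le_one _
      _ = _ := by ring
  have h1' : sphereCos e φ r ^ 2 ≤ 1 := (sq_le_one_iff_abs_le_one _).2 h1
  have h2' : sphereCosDeriv e φ r ^ 2 ≤ (2 * Real.pi) ^ 2 := sq_le_sq.2 (h2.trans (le_abs_self _))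
  nlinarith

/-- The derivative of `t ↦ \widehat{dσ}(tξ)`. -/
def sigmaHatDeriv (d : ℕ) (t : ℝ) (ξ : Ed d) : ℂ :=
  ∫ y : sphere (0 : Ed d) 1, (-(2 * Real.pi * ⟪ξ, (y : Ed d)⟫) : ℝ) * Complex.I *
    eChar (-(2 * Real.pi * (t * ⟪ξ, (y : Ed d)⟫))) ∂(sphereProb d)

theorem hasDerivAt_sigmaHat {d : ℕ} (t : ℝ) (ξ : Ed d) :
    HasDerivAt (fun s : ℝ => sigmaHat d (s • ξ)) (sigmaHatDeriv d t ξ) t := by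
  simp only [sigmaHat, inner_smul_left]
  refine hasDerivAt_integral_sphere (d := d)
    (F := fun t y => eChar (-(2 * Real.pi * (t * ⟪ξ, (y : Ed d)⟫))))
    (F' := fun t y => (-(2 * Real.pi * ⟪ξ, (y : Ed d)⟫) : ℝ) * Complex.I *
      eChar (-(2 * Real.pi * (t * ⟪ξ, (y : Ed d)⟫)))) (fun t => ?_) ?_ (fun t y => ?_) t
  · fun_prop
  · fun_prop
  simp only [eChar]
  have : HasDerivAt (fun s : ℝ => -(2 * Real.pi * (s * ⟪ξ, (y : Ed d)⟫)))
      (-(2 * Real.pi * ⟪ξ, (y : Ed d)⟫)) t := by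
    simpa using! (((hasDerivAt_id t).mul_const ⟪ξ, (y : Ed d)⟫).const_mul (2 * Real.pi)).neg
  convert! (this.ofReal_comp.mul_const Complex.I).cexp using 1
  ring

theorem eChar_eq (x : ℝ) : eChar (-x) = (Real.cos x : ℂ) - Complex.I * Real.sin x := by
  rw [eChar, Complex.exp_mul_I]
  push_cast
  rw [Complex.cos_neg, Complex.sin_neg]
  ring

theorem sigmaHat_smul_eq {d : ℕ} (e : Ed d) (r : ℝ) :
    sigmaHat d (r • e) = (sphereCos e 0 r : ℂ) - Complex.I * sphereCos e (-(Real.pi / 2)) r := by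
  rw [sigmaHat, sphereCos, sphereCos, ← integral_complex_ofReal, ← integral_complex_ofReal,
    ← integral_const_mul, ← integral_sub (integrable_sphere (by fun_prop))
      (integrable_sphere (by fun_prop))]
  refine integral_congr_ae (.of_forall fun y => ?_)
  simp only [eChar_eq, ← sub_eq_add_neg, Real.cos_sub_pi_div_two, inner_smul_left]
  simp [mul_assoc]

theorem sigmaHatDeriv_eq {d : ℕ} (e : Ed d) (c t : ℝ) :
    sigmaHatDeriv d t (c • e) = c * ((sphereCosDeriv e 0 (t * c) : ℂ) -
      Complex.I * sphereCosDeriv e (-(Real.pi / 2)) (t * c)) := by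
  rw [sigmaHatDeriv, sphereCosDeriv, sphereCosDeriv, ← integral_complex_ofReal,
    ← integral_complex_ofReal,
    ← integral_const_mul, ← integral_sub (integrable_sphere (by fun_prop))
      (integrable_sphere (by fun_prop)), ← integral_const_mul]
  refine integral_congr_ae (.of_forall fun y => ?_)
  simp only [eChar_eq, ← sub_eq_add_neg, Real.sin_sub_pi_div_two, inner_smul_left]
  simp only [add_zero]
  rw [show 2 * Real.pi * (t * c) * ⟪e, (y : Ed d)⟫ =
    2 * Real.pi * (t * (c * ⟪e, (y : Ed d)⟫)) by ring]
  simp only [RCLike.conj_to_real]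
  generalize Real.sin _ = S
  push_cast
  linear_combination (2 * Real.pi * (c * (⟪e, (y : Ed d)⟫ * S)) : ℂ) * Complex.I_sq

theorem norm_sub_I_mul_sq (a b : ℝ) : ‖(a : ℂ) - Complex.I * b‖ ^ 2 = a ^ 2 + b ^ 2 := by
  rw [← Complex.normSq_eq_norm_sq, Complex.normSq_apply]
  simp
  ring

theorem sigmaHat_decay {d : ℕ} (hd : 2 ≤ d) : ∃ C : ℝ, 0 < C ∧ ∀ (t : ℝ) (ξ : Ed d), 0 ≤ t →
    (t * ‖ξ‖) ^ (d - 1) * ‖sigmaHat d (t • ξ)‖ ^ 2 ≤ C ∧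
    (t * ‖ξ‖) ^ (d - 1) * ‖sigmaHatDeriv d t ξ‖ ^ 2 ≤ C * ‖ξ‖ ^ 2 := by
  obtain ⟨m, rfl⟩ := Nat.exists_eq_add_of_le' hd
  refine ⟨2 * (3 * Real.exp 1 * (m + 1) ^ (m + 1) * (2 * (4 * Real.pi ^ 2))), by positivity,
    fun t ξ ht => ?_⟩
  set K := 3 * Real.exp 1 * ((m : ℝ) + 1) ^ (m + 1) * (2 * (4 * Real.pi ^ 2)) with hK
  have hK0 : 0 < K := by positivity
  have hpi := Real.pi_gt_three
  rcases eq_or_ne ξ 0 with rfl | hξ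
  · simp [hK0.le]
  have hne : ‖ξ‖ ≠ 0 := norm_ne_zero_iff.2 hξ
  set e : Ed (m + 2) := ‖ξ‖⁻¹ • ξ with he
  have he1 : ‖e‖ = 1 := by rw [he, norm_smul, norm_inv, norm_norm, inv_mul_cancel₀ hne]
  have hξe : ξ = ‖ξ‖ • e := by rw [he, smul_smul, mul_inv_cancel₀ hne, one_smul]
  have hr : 0 ≤ t * ‖ξ‖ := by positivity
  have h1 := sphereCos_decay he1 0 hr
  have h2 := sphereCos_decay he1 (-(Real.pi / 2)) hr
  have e1 : sigmaHat (m + 2) (t • ξ) = sigmaHat (m + 2) ((t * ‖ξ‖) • e) := by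
    conv_lhs => rw [hξe, smul_smul]
  have e2 : sigmaHatDeriv (m + 2) t ξ = sigmaHatDeriv (m + 2) t (‖ξ‖ • e) := by rw [← hξe]
  rw [← hK] at h1 h2
  have hp : 0 ≤ (t * ‖ξ‖) ^ (m + 1) := by positivity
  have h4 : (1 : ℝ) ≤ 4 * Real.pi ^ 2 := by nlinarith
  constructor
  · rw [e1, sigmaHat_smul_eq, norm_sub_I_mul_sq]
    simp only [Nat.add_succ_sub_one]
    have ha : ∀ φ, sphereCos e φ (t * ‖ξ‖) ^ 2 ≤ sphereCosDeriv e φ (t * ‖ξ‖) ^ 2 +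
        4 * Real.pi ^ 2 * sphereCos e φ (t * ‖ξ‖) ^ 2 := fun φ => by
      nlinarith [sq_nonneg (sphereCosDeriv e φ (t * ‖ξ‖)), sq_nonneg (sphereCos e φ (t * ‖ξ‖))]
    have h5 := (mul_le_mul_of_nonneg_left (ha 0) hp).trans h1
    have h6 := (mul_le_mul_of_nonneg_left (ha (-(Real.pi / 2))) hp).trans h2
    linarith
  · rw [e2, sigmaHatDeriv_eq, norm_mul, mul_pow ‖(‖ξ‖ : ℂ)‖, norm_sub_I_mul_sq]
    simp only [Nat.add_succ_sub_one, Complex.norm_real, norm_norm]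
    have ha : ∀ φ, sphereCosDeriv e φ (t * ‖ξ‖) ^ 2 ≤ sphereCosDeriv e φ (t * ‖ξ‖) ^ 2 +
        4 * Real.pi ^ 2 * sphereCos e φ (t * ‖ξ‖) ^ 2 := fun φ => by
      have := mul_nonneg (zero_le_one.trans h4) (sq_nonneg (sphereCos e φ (t * ‖ξ‖)))
      linarith
    have h5 := (mul_le_mul_of_nonneg_left (ha 0) hp).trans h1
    have h6 := (mul_le_mul_of_nonneg_left (ha (-(Real.pi / 2))) hp).trans h2
    have h7 := mul_le_mul_of_nonneg_left (add_le_add h5 h6) (sq_nonneg ‖ξ‖)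
    linarith

/-- The Fourier multiplier operator with multiplier `m`. -/
def multOp {d : ℕ} (m : Ed d → ℂ) (h : Ed d → ℂ) (x : Ed d) : ℂ :=
  ∫ ξ : Ed d, eChar (2 * Real.pi * ⟪ξ, x⟫) * (m ξ * fourierInt d h ξ)

theorem integrable_indicator_bound {d : ℕ} (R c : ℝ) :
    Integrable ((closedBall (0 : Ed d) R).indicator fun _ => c) :=
  (integrable_indicator_iff measurableSet_closedBall).2
    (integrableOn_const (by exact (isCompact_closedBall _ _).measure_lt_top.ne))

theorem norm_mult_le {d : ℕ} {m h : Ed d → ℂ} {B R : ℝ} (hB : ∀ ξ, ‖m ξ‖ ≤ B)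
    (hR : ∀ ξ, R < ‖ξ‖ → m ξ = 0) (ξ : Ed d) : ‖m ξ * fourierInt d h ξ‖ ≤
      (closedBall (0 : Ed d) R).indicator (fun _ => B * ∫ x, ‖h x‖) ξ := by
  by_cases hξ : ξ ∈ closedBall (0 : Ed d) R
  · rw [indicator_of_mem hξ, norm_mul]
    exact mul_le_mul (hB ξ) (norm_fourierInt_le h ξ) (norm_nonneg _) ((norm_nonneg _).trans (hB ξ))
  · rw [indicator_of_notMem hξ, hR ξ (by simpa using hξ)]
    simp

theorem integrable_mult {d : ℕ} {m h : Ed d → ℂ} {B R : ℝ} (hm : Continuous m)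
    (hB : ∀ ξ, ‖m ξ‖ ≤ B) (hR : ∀ ξ, R < ‖ξ‖ → m ξ = 0) (hh : Integrable h) :
    Integrable (fun ξ => m ξ * fourierInt d h ξ) := by
  have := continuous_fourierInt hh
  exact (integrable_indicator_bound R _).mono' (by fun_prop : Continuous _).aestronglyMeasurable
    (.of_forall (norm_mult_le hB hR))

theorem continuous_multOp {d : ℕ} {m h : Ed d → ℂ} {B R : ℝ} (hm : Continuous m)
    (hB : ∀ ξ, ‖m ξ‖ ≤ B) (hR : ∀ ξ, R < ‖ξ‖ → m ξ = 0) (hh : Integrable h) :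
    Continuous (multOp m h) := by
  have := continuous_fourierInt hh
  refine continuous_of_dominated (fun x => (by fun_prop : Continuous _).aestronglyMeasurable)
    (fun x => .of_forall fun ξ => ?_) (integrable_mult hm hB hR hh).norm
    (.of_forall fun ξ => by fun_prop)
  rw [norm_mul, norm_eChar, one_mul]

theorem lintegral_multOp_sq_le {d : ℕ} {m h : Ed d → ℂ} {B R : ℝ} (hm : Continuous m)
    (hB : ∀ ξ, ‖m ξ‖ ≤ B) (hR : ∀ ξ, R < ‖ξ‖ → m ξ = 0) (hh : Integrable h) (hh2 : MemLp h 2) :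
    ∫⁻ x, ‖multOp m h x‖ₑ ^ 2 ≤ ENNReal.ofReal B ^ 2 * ∫⁻ x, ‖h x‖ₑ ^ 2 := by
  have hB0 : 0 ≤ B := (norm_nonneg _).trans (hB 0)
  have hcont := continuous_fourierInt hh
  have hmL : MemLp (fun ξ => m ξ * fourierInt d h ξ) 2 :=
    (memLp_fourierInt hh hh2).of_le_mul (c := B) (by fun_prop : Continuous _).aestronglyMeasurable
      (.of_forall fun ξ => by
        rw [norm_mul]; exact mul_le_mul_of_nonneg_right (hB ξ) (norm_nonneg _))
  calc ∫⁻ x, ‖multOp m h x‖ₑ ^ 2 = ∫⁻ ξ, ‖m ξ * fourierInt d h ξ‖ₑ ^ 2 :=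
        lintegral_fourierIntInv_sq (integrable_mult hm hB hR hh) hmL
    _ ≤ ∫⁻ ξ, ENNReal.ofReal B ^ 2 * ‖fourierInt d h ξ‖ₑ ^ 2 := by
        refine lintegral_mono fun ξ => ?_
        rw [enorm_mul, mul_pow]
        gcongr
        rw [← ofReal_norm]
        exact ENNReal.ofReal_le_ofReal (hB ξ)
    _ = _ := by
        rw [lintegral_const_mul _ (by fun_prop), lintegral_fourierInt_sq hh hh2]

theorem enorm_multOp_le {d : ℕ} {M M' : ℝ → Ed d → ℂ} {h : Ed d → ℂ} {a δ A B R : ℝ}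
    (hM : ∀ t, Continuous (M t)) (hM' : Continuous fun q : ℝ × Ed d => M' q.1 q.2)
    (hder : ∀ t ξ, HasDerivAt (fun s => M s ξ) (M' t ξ) t)
    (hA : ∀ t ∈ Icc a (a + δ), ∀ ξ, ‖M t ξ‖ ≤ A) (hB : ∀ t ∈ Icc a (a + δ), ∀ ξ, ‖M' t ξ‖ ≤ B)
    (hR : ∀ t ∈ Icc a (a + δ), ∀ ξ, R < ‖ξ‖ → M t ξ = 0)
    (hR' : ∀ t ∈ Icc a (a + δ), ∀ ξ, R < ‖ξ‖ → M' t ξ = 0) (hh : Integrable h)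
    {t : ℝ} (ht : t ∈ Icc a (a + δ)) (x : Ed d) :
    ‖multOp (M t) h x‖ₑ ≤ ‖multOp (M a) h x‖ₑ +
      ∫⁻ s in Icc a (a + δ), ‖multOp (M' s) h x‖ₑ := by
  have hcont := continuous_fourierInt hh
  have ha : a ∈ Icc a (a + δ) := ⟨le_rfl, ht.1.trans ht.2⟩
  let F : Ed d → ℝ → ℂ := fun ξ s => eChar (2 * Real.pi * ⟪ξ, x⟫) * (M' s ξ * fourierInt d h ξ)
  have hFc : Continuous (Function.uncurry F) := by
    have : Continuous fun q : Ed d × ℝ => M' q.2 q.1 := hM'.comp continuous_swap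
    simp only [F, Function.uncurry_def]
    fun_prop
  have hFi : Integrable (Function.uncurry F) (volume.prod (volume.restrict (Ioc a t))) := by
    refine Integrable.mono' (g := fun q : Ed d × ℝ => (closedBall (0 : Ed d) R).indicator
      (fun _ => B * ∫ x, ‖h x‖) q.1 * 1)
      ((integrable_indicator_bound R _).mul_prod (integrable_const 1))
      hFc.aestronglyMeasurable ?_
    have hprod : (volume : Measure (Ed d)).prod (volume.restrict (Ioc a t)) =
        (volume.prod volume).restrict (univ ×ˢ Ioc a t) := by
      rw [← Measure.prod_restrict, Measure.restrict_univ]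
    rw [hprod]
    refine (ae_restrict_iff' (MeasurableSet.univ.prod measurableSet_Ioc)).2 (.of_forall ?_)
    rintro ⟨ξ, s⟩ hs
    have hs' : s ∈ Icc a (a + δ) := ⟨hs.2.1.le, hs.2.2.trans ht.2⟩
    simp only [Function.uncurry, F, norm_mul, norm_eChar, one_mul, mul_one]
    rw [← norm_mul]
    exact norm_mult_le (hB s hs') (hR' s hs') ξ
  have key : multOp (M t) h x - multOp (M a) h x = ∫ s in Ioc a t, multOp (M' s) h x := by
    have hi : ∀ s ∈ Icc a (a + δ), Integrable (fun ξ : Ed d => eChar (2 * Real.pi * ⟪ξ, x⟫) *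
        (M s ξ * fourierInt d h ξ)) := fun s hs => by
      refine (integrable_mult (hM s) (hA s hs) (hR s hs) hh).mono ?_ (.of_forall fun ξ => ?_)
      · have := hM s
        exact (by fun_prop : Continuous _).aestronglyMeasurable
      · rw [norm_mul, norm_eChar, one_mul]
    rw [multOp, multOp, ← integral_sub (hi t ht) (hi a ha)]
    calc _ = ∫ ξ, ∫ s in Ioc a t, F ξ s := by
          refine integral_congr_ae (.of_forall fun ξ => ?_)
          have hcs : Continuous fun s => M' s ξ := hM'.comp (by fun_prop : Continuous fun s => (s, ξ))
          have h1 : ∫ s in a..t, M' s ξ = M t ξ - M a ξ :=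
            intervalIntegral.integral_eq_sub_of_hasDerivAt (fun s _ => hder s ξ)
              (hcs.intervalIntegrable _ _)
          rw [intervalIntegral.integral_of_le ht.1] at h1
          simp only [F]
          rw [integral_const_mul, integral_mul_const, h1]
          ring
      _ = ∫ s in Ioc a t, ∫ ξ, F ξ s := integral_integral_swap hFi
      _ = _ := rfl
  have h2 : multOp (M t) h x = multOp (M a) h x + ∫ s in Ioc a t, multOp (M' s) h x := by
    rw [← key]; ring
  rw [h2]
  refine (enorm_add_le _ _).trans (add_le_add_right ?_ _)
  refine (enorm_integral_le_lintegral_enorm _).trans (lintegral_mono_set ?_)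
  exact fun s hs => ⟨hs.1.le, hs.2.trans ht.2⟩

theorem add_sq_le_two_mul (u v : ℝ≥0∞) : (u + v) ^ 2 ≤ 2 * (u ^ 2 + v ^ 2) := by
  have := ENNReal.rpow_add_le_mul_rpow_add_rpow u v (p := 2) (by norm_num)
  norm_num at this
  exact_mod_cast this

theorem sq_lintegral_le {α : Type*} [MeasurableSpace α] (μ : Measure α) {φ : α → ℝ≥0∞}
    (hφ : AEMeasurable φ μ) : (∫⁻ s, φ s ∂μ) ^ 2 ≤ μ univ * ∫⁻ s, φ s ^ 2 ∂μ := by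
  have h := ENNReal.lintegral_mul_le_Lp_mul_Lq μ (p := 2) (q := 2)
    Real.HolderConjugate.two_two hφ (aemeasurable_const (b := 1))
  simp only [Pi.mul_apply, mul_one, ENNReal.one_rpow, lintegral_const, one_mul] at h
  calc _ ≤ ((∫⁻ s, φ s ^ (2 : ℝ) ∂μ) ^ (1 / 2 : ℝ) * (μ univ) ^ (1 / 2 : ℝ)) ^ 2 := by gcongr
    _ = _ := by
      rw [mul_pow, ← ENNReal.rpow_natCast, ← ENNReal.rpow_natCast, ← ENNReal.rpow_mul,
        ← ENNReal.rpow_mul]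
      norm_num [mul_comm]

theorem measurable_enorm_multOp {d : ℕ} {M' : ℝ → Ed d → ℂ} {h : Ed d → ℂ}
    (hM' : Continuous fun q : ℝ × Ed d => M' q.1 q.2) (hh : Integrable h) :
    Measurable fun q : Ed d × ℝ => ‖multOp (M' q.2) h q.1‖ₑ := by
  have hcont := continuous_fourierInt hh
  have hc : Continuous fun w : (Ed d × ℝ) × Ed d => eChar (2 * Real.pi * ⟪w.2, w.1.1⟫) *
      (M' w.1.2 w.2 * fourierInt d h w.2) := by
    have : Continuous fun w : (Ed d × ℝ) × Ed d => M' w.1.2 w.2 :=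
      hM'.comp (by fun_prop : Continuous fun w : (Ed d × ℝ) × Ed d => (w.1.2, w.2))
    fun_prop
  exact (hc.stronglyMeasurable.integral_prod_right (ν := volume)).measurable.enorm

/-- `L²` bound for the maximal function of a one-parameter family of multipliers over an
interval of length `δ`. -/
theorem lintegral_iSup_multOp_sq_le {d : ℕ} {M M' : ℝ → Ed d → ℂ} {h : Ed d → ℂ} {a δ A B R : ℝ}
    (hδ : 0 ≤ δ)
    (hM : ∀ t, Continuous (M t)) (hM' : Continuous fun q : ℝ × Ed d => M' q.1 q.2)
    (hder : ∀ t ξ, HasDerivAt (fun s => M s ξ) (M' t ξ) t)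
    (hA : ∀ t ∈ Icc a (a + δ), ∀ ξ, ‖M t ξ‖ ≤ A) (hB : ∀ t ∈ Icc a (a + δ), ∀ ξ, ‖M' t ξ‖ ≤ B)
    (hR : ∀ t ∈ Icc a (a + δ), ∀ ξ, R < ‖ξ‖ → M t ξ = 0)
    (hR' : ∀ t ∈ Icc a (a + δ), ∀ ξ, R < ‖ξ‖ → M' t ξ = 0) (hh : Integrable h)
    (hh2 : MemLp h 2) :
    ∫⁻ x, (⨆ t ∈ Icc a (a + δ), ‖multOp (M t) h x‖ₑ) ^ 2 ≤
      ENNReal.ofReal (2 * (A ^ 2 + (δ * B) ^ 2)) * ∫⁻ x, ‖h x‖ₑ ^ 2 := by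
  have hcont := continuous_fourierInt hh
  have ha : a ∈ Icc a (a + δ) := ⟨le_rfl, by linarith⟩
  have hA0 : 0 ≤ A := (norm_nonneg _).trans (hA a ha 0)
  have hB0 : 0 ≤ B := (norm_nonneg _).trans (hB a ha 0)
  have hSm := measurable_enorm_multOp hM' hh
  have hSx : ∀ x, Measurable fun s => ‖multOp (M' s) h x‖ₑ := fun x =>
    Measurable.of_uncurry_left (f := fun x s => ‖multOp (M' s) h x‖ₑ) hSm
  calc _ ≤ ∫⁻ x, 2 * (‖multOp (M a) h x‖ₑ ^ 2 + ENNReal.ofReal δ *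
        ∫⁻ s in Icc a (a + δ), ‖multOp (M' s) h x‖ₑ ^ 2) := by
        refine lintegral_mono fun x => ?_
        refine (pow_le_pow_left' (iSup₂_le fun t ht =>
          enorm_multOp_le hM hM' hder hA hB hR hR' hh ht x) 2).trans ?_
        refine (add_sq_le_two_mul _ _).trans ?_
        gcongr
        refine (sq_lintegral_le _ (hSx x).aemeasurable).trans ?_
        simp
    _ = 2 * ((∫⁻ x, ‖multOp (M a) h x‖ₑ ^ 2) + ENNReal.ofReal δ *
        ∫⁻ s in Icc a (a + δ), ∫⁻ x, ‖multOp (M' s) h x‖ₑ ^ 2) := by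
        have hc := continuous_multOp (hM a) (hA a ha) (hR a ha) hh
        rw [lintegral_const_mul' _ _ (by norm_num), lintegral_add_left (by fun_prop),
          lintegral_const_mul' _ _ ENNReal.ofReal_ne_top, lintegral_lintegral_swap]
        exact (hSm.pow_const 2).aemeasurable
    _ ≤ 2 * (ENNReal.ofReal A ^ 2 * (∫⁻ x, ‖h x‖ₑ ^ 2) + ENNReal.ofReal δ *
        ∫⁻ s in Icc a (a + δ), ENNReal.ofReal B ^ 2 * ∫⁻ x, ‖h x‖ₑ ^ 2) := by
        have h2 : ∫⁻ s in Icc a (a + δ), ∫⁻ x, ‖multOp (M' s) h x‖ₑ ^ 2 ≤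
            ∫⁻ s in Icc a (a + δ), ENNReal.ofReal B ^ 2 * ∫⁻ x, ‖h x‖ₑ ^ 2 :=
          setLIntegral_mono' measurableSet_Icc fun s hs =>
            lintegral_multOp_sq_le (hM'.comp (by fun_prop : Continuous fun ξ => (s, ξ)))
              (hB s hs) (hR' s hs) hh hh2
        have h1 := lintegral_multOp_sq_le (hM a) (hA a ha) (hR a ha) hh hh2
        exact mul_le_mul_right (add_le_add h1 (mul_le_mul_right h2 _)) _
    _ = _ := by
        rw [setLIntegral_const, Real.volume_Icc, add_sub_cancel_left,
          ENNReal.ofReal_mul (by norm_num), ENNReal.ofReal_add (by positivity) (by positivity),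
          ENNReal.ofReal_pow hA0, ENNReal.ofReal_pow (by positivity), ENNReal.ofReal_mul hδ,
          ENNReal.ofReal_ofNat]
        ring

theorem continuous_integral_sphere {d : ℕ} {X : Type*} [TopologicalSpace X]
    [FirstCountableTopology X] [LocallyCompactSpace X] {F : X → sphere (0 : Ed d) 1 → ℂ}
    (hF : Continuous (Function.uncurry F)) : Continuous fun x => ∫ y, F x y ∂(sphereProb d) := by
  simpa using continuous_parametric_integral_of_continuous (μ := sphereProb d) hF isCompact_univ

@[fun_prop]
theorem continuous_sigmaHat {d : ℕ} : Continuous (sigmaHat d) :=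
  continuous_integral_sphere (by fun_prop)

theorem continuous_sigmaHatDeriv {d : ℕ} :
    Continuous fun q : ℝ × Ed d => sigmaHatDeriv d q.1 q.2 := by
  unfold sigmaHatDeriv
  refine continuous_integral_sphere ?_
  simp only [Function.uncurry_def]
  fun_prop

/-- The annular profile `β₀(η) - β₀(2η)`, of which `β_j` is a dilate. -/
def annulusBump {d : ℕ} (β0 : Ed d → ℝ) (η : Ed d) : ℝ := β0 η - β0 ((2 : ℝ) • η)

theorem betaJ_eq {d : ℕ} (β0 : Ed d → ℝ) (j : ℕ) (ξ : Ed d) :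
    betaJ d β0 j ξ = annulusBump β0 (((2 : ℝ) ^ j)⁻¹ • ξ) := by
  rw [betaJ, annulusBump, smul_smul, zpow_neg, zpow_natCast, zpow_sub₀ two_ne_zero, zpow_one,
    zpow_natCast, div_eq_mul_inv]

namespace IsAdmissibleBump

variable {d : ℕ} {β0 : Ed d → ℝ}

theorem contDiff_annulusBump (hβ : IsAdmissibleBump d β0) :
    ContDiff ℝ (⊤ : ℕ∞) (annulusBump β0) :=
  hβ.1.sub (hβ.1.comp (contDiff_const_smul _))

theorem annulusBump_eq_zero_of_lt (hβ : IsAdmissibleBump d β0) {η : Ed d} (h : ‖η‖ < 1 / 2) :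
    annulusBump β0 η = 0 := by
  rw [annulusBump, hβ.2.2.2.1 _ (by linarith), hβ.2.2.2.1, sub_self]
  rw [norm_smul, Real.norm_ofNat]; linarith

theorem annulusBump_eq_zero_of_gt (hβ : IsAdmissibleBump d β0) {η : Ed d} (h : 2 < ‖η‖) :
    annulusBump β0 η = 0 := by
  rw [annulusBump, hβ.2.2.2.2 _ h.le, hβ.2.2.2.2, sub_self]
  rw [norm_smul, Real.norm_ofNat]; linarith

theorem fderiv_annulusBump_eq_zero_of_lt (hβ : IsAdmissibleBump d β0) {η : Ed d}
    (h : ‖η‖ < 1 / 2) : fderiv ℝ (annulusBump β0) η = 0 := by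
  have : annulusBump β0 =ᶠ[𝓝 η] fun _ => 0 :=
    (isOpen_lt continuous_norm continuous_const).eventually_mem h |>.mono fun _ hx =>
      hβ.annulusBump_eq_zero_of_lt hx
  rw [this.fderiv_eq, fderiv_fun_const, Pi.zero_apply]

theorem fderiv_annulusBump_eq_zero_of_gt (hβ : IsAdmissibleBump d β0) {η : Ed d}
    (h : 2 < ‖η‖) : fderiv ℝ (annulusBump β0) η = 0 := by
  have : annulusBump β0 =ᶠ[𝓝 η] fun _ => 0 :=
    (isOpen_lt continuous_const continuous_norm).eventually_mem h |>.mono fun _ hx =>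
      hβ.annulusBump_eq_zero_of_gt hx
  rw [this.fderiv_eq, fderiv_fun_const, Pi.zero_apply]

theorem hasCompactSupport_annulusBump (hβ : IsAdmissibleBump d β0) :
    HasCompactSupport (annulusBump β0) :=
  .intro (isCompact_closedBall 0 2) fun _ hx =>
    hβ.annulusBump_eq_zero_of_gt (by simpa using hx)

theorem exists_bound_annulusBump (hβ : IsAdmissibleBump d β0) :
    ∃ K, 0 < K ∧ ∀ η, |annulusBump β0 η| ≤ K ∧ ‖fderiv ℝ (annulusBump β0) η‖ ≤ K := by
  obtain ⟨K₁, h₁⟩ := hβ.hasCompactSupport_annulusBump.exists_bound_of_continuous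
    hβ.contDiff_annulusBump.continuous
  obtain ⟨K₂, h₂⟩ := (hβ.hasCompactSupport_annulusBump.fderiv ℝ).exists_bound_of_continuous
    (hβ.contDiff_annulusBump.continuous_fderiv (by simp))
  exact ⟨max (max K₁ K₂) 1, by positivity, fun η =>
    ⟨(h₁ η).trans (by simp), (h₂ η).trans (by simp)⟩⟩

end IsAdmissibleBump

/-- The multiplier of `A_t^j`. -/
def AjMult {d : ℕ} (β0 : Ed d → ℝ) (j : ℕ) (t : ℝ) (ξ : Ed d) : ℂ :=
  sigmaHat d (t • ξ) * (betaJ d β0 j (t • ξ) : ℂ)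

/-- The derivative in `t` of the multiplier of `A_t^j`. -/
def AjMultDeriv {d : ℕ} (β0 : Ed d → ℝ) (j : ℕ) (t : ℝ) (ξ : Ed d) : ℂ :=
  sigmaHatDeriv d t ξ * (betaJ d β0 j (t • ξ) : ℂ) + sigmaHat d (t • ξ) *
    (fderiv ℝ (annulusBump β0) (((2 : ℝ) ^ j)⁻¹ • t • ξ) (((2 : ℝ) ^ j)⁻¹ • ξ) : ℝ)

namespace IsAdmissibleBump

variable {d : ℕ} {β0 : Ed d → ℝ}

theorem continuous_betaJ (hβ : IsAdmissibleBump d β0) (j : ℕ) : Continuous (betaJ d β0 j) := by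
  have := hβ.1.continuous
  unfold betaJ
  fun_prop

theorem continuous_AjMult (hβ : IsAdmissibleBump d β0) (j : ℕ) (t : ℝ) :
    Continuous (AjMult β0 j t) := by
  have := hβ.continuous_betaJ j
  unfold AjMult
  fun_prop

theorem continuous_AjMultDeriv (hβ : IsAdmissibleBump d β0) (j : ℕ) :
    Continuous fun q : ℝ × Ed d => AjMultDeriv β0 j q.1 q.2 := by
  have := hβ.continuous_betaJ j
  have := hβ.contDiff_annulusBump.continuous_fderiv (by simp)
  have := continuous_sigmaHatDeriv (d := d)
  unfold AjMultDeriv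
  fun_prop

theorem hasDerivAt_AjMult (hβ : IsAdmissibleBump d β0) (j : ℕ) (t : ℝ) (ξ : Ed d) :
    HasDerivAt (fun s => AjMult β0 j s ξ) (AjMultDeriv β0 j t ξ) t := by
  refine (hasDerivAt_sigmaHat t ξ).mul (HasDerivAt.ofReal_comp ?_)
  simp only [betaJ_eq]
  have h := (hβ.contDiff_annulusBump.differentiable (by simp)
    (((2 : ℝ) ^ j)⁻¹ • t • ξ)).hasFDerivAt
  refine h.comp_hasDerivAt (f := fun s : ℝ => ((2 : ℝ) ^ j)⁻¹ • s • ξ) t ?_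
  simpa using! ((hasDerivAt_id t).smul_const ξ).const_smul (((2 : ℝ) ^ j)⁻¹)

theorem AjMult_eq_zero (hβ : IsAdmissibleBump d β0) {j : ℕ} {t : ℝ} (ht : 0 < t) {ξ : Ed d}
    (h : t * ‖ξ‖ < 2 ^ j / 2 ∨ 2 * 2 ^ j < t * ‖ξ‖) :
    AjMult β0 j t ξ = 0 ∧ AjMultDeriv β0 j t ξ = 0 := by
  have hn : ‖((2 : ℝ) ^ j)⁻¹ • t • ξ‖ = t * ‖ξ‖ / 2 ^ j := by
    rw [norm_smul, norm_smul, norm_inv, norm_pow, Real.norm_ofNat, Real.norm_of_nonneg ht.le]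
    ring
  have hp : (0 : ℝ) < 2 ^ j := by positivity
  rw [AjMult, AjMultDeriv, betaJ_eq]
  rcases h with h | h
  · have h' : ‖((2 : ℝ) ^ j)⁻¹ • t • ξ‖ < 1 / 2 := by rw [hn, div_lt_iff₀ hp]; linarith
    rw [hβ.annulusBump_eq_zero_of_lt h', hβ.fderiv_annulusBump_eq_zero_of_lt h']
    simp
  · have h' : 2 < ‖((2 : ℝ) ^ j)⁻¹ • t • ξ‖ := by rw [hn, lt_div_iff₀ hp]; linarith
    rw [hβ.annulusBump_eq_zero_of_gt h', hβ.fderiv_annulusBump_eq_zero_of_gt h']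
    simp

theorem exists_AjMult_bound (hβ : IsAdmissibleBump d β0) (hd : 2 ≤ d) :
    ∃ C, 0 < C ∧ ∀ (j : ℕ) (t : ℝ) (ξ : Ed d), 0 < t →
      (2 ^ j) ^ (d - 1) * ‖AjMult β0 j t ξ‖ ^ 2 ≤ C ∧
      (2 ^ j) ^ (d - 1) * ‖AjMultDeriv β0 j t ξ‖ ^ 2 ≤ C * ‖ξ‖ ^ 2 := by
  obtain ⟨C, hC0, hC⟩ := sigmaHat_decay hd
  obtain ⟨K, hK0, hK⟩ := hβ.exists_bound_annulusBump
  refine ⟨4 * 2 ^ (d - 1) * C * K ^ 2, by positivity, fun j t ξ ht => ?_⟩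
  by_cases hlt : t * ‖ξ‖ < 2 ^ j / 2
  · obtain ⟨h1, h2⟩ := hβ.AjMult_eq_zero ht (.inl hlt)
    rw [h1, h2]
    simp only [norm_zero, ne_eq, OfNat.ofNat_ne_zero, not_false_eq_true, zero_pow, mul_zero]
    exact ⟨by positivity, by positivity⟩
  have hge : ((2 : ℝ) ^ j) ^ (d - 1) ≤ 2 ^ (d - 1) * (t * ‖ξ‖) ^ (d - 1) := by
    rw [← mul_pow]
    exact pow_le_pow_left₀ (by positivity) (by linarith) _
  set P : ℝ := (2 ^ j) ^ (d - 1)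
  set Q : ℝ := 2 ^ (d - 1)
  have hP : 0 < P := by positivity
  have hQ : 0 < Q := by positivity
  obtain ⟨s1, s2⟩ := hC t ξ ht.le
  have hs : P * ‖sigmaHat d (t • ξ)‖ ^ 2 ≤ Q * C := by
    calc _ ≤ (Q * (t * ‖ξ‖) ^ (d - 1)) * ‖sigmaHat d (t • ξ)‖ ^ 2 := by gcongr
      _ ≤ _ := by rw [mul_assoc]; gcongr
  have hs' : P * ‖sigmaHatDeriv d t ξ‖ ^ 2 ≤ Q * C * ‖ξ‖ ^ 2 := by
    calc _ ≤ (Q * (t * ‖ξ‖) ^ (d - 1)) * ‖sigmaHatDeriv d t ξ‖ ^ 2 := by gcongr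
      _ ≤ _ := by rw [mul_assoc, mul_assoc]; gcongr
  have hb : ‖(betaJ d β0 j (t • ξ) : ℂ)‖ ≤ K := by
    rw [betaJ_eq, Complex.norm_real]; exact (hK _).1
  have hb' : ‖((fderiv ℝ (annulusBump β0) (((2 : ℝ) ^ j)⁻¹ • t • ξ)
      (((2 : ℝ) ^ j)⁻¹ • ξ) : ℝ) : ℂ)‖ ≤ K * ‖ξ‖ := by
    rw [Complex.norm_real]
    refine (ContinuousLinearMap.le_of_opNorm_le _ (hK _).2 _).trans ?_
    rw [norm_smul, norm_inv, norm_pow, Real.norm_ofNat]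
    have : ((2 : ℝ) ^ j)⁻¹ ≤ 1 := inv_le_one_of_one_le₀ (one_le_pow₀ (by norm_num))
    exact mul_le_mul_of_nonneg_left (mul_le_of_le_one_left (norm_nonneg _) this) hK0.le
  constructor
  · rw [AjMult, norm_mul, mul_pow, ← mul_assoc]
    calc _ ≤ Q * C * K ^ 2 := by gcongr
      _ ≤ _ := by nlinarith [show 0 < Q * C * K ^ 2 by positivity]
  · have h1 : ‖AjMultDeriv β0 j t ξ‖ ≤
        ‖sigmaHatDeriv d t ξ‖ * K + ‖sigmaHat d (t • ξ)‖ * (K * ‖ξ‖) := by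
      refine (norm_add_le _ _).trans ?_
      rw [norm_mul, norm_mul]
      gcongr
    calc _ ≤ P * (‖sigmaHatDeriv d t ξ‖ * K + ‖sigmaHat d (t • ξ)‖ * (K * ‖ξ‖)) ^ 2 := by gcongr
      _ ≤ P * (2 * ((‖sigmaHatDeriv d t ξ‖ * K) ^ 2 + (‖sigmaHat d (t • ξ)‖ * (K * ‖ξ‖)) ^ 2)) := by
        gcongr; exact add_sq_le
      _ = 2 * K ^ 2 * (P * ‖sigmaHatDeriv d t ξ‖ ^ 2) +
          2 * K ^ 2 * ‖ξ‖ ^ 2 * (P * ‖sigmaHat d (t • ξ)‖ ^ 2) := by ring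
      _ ≤ 2 * K ^ 2 * (Q * C * ‖ξ‖ ^ 2) + 2 * K ^ 2 * ‖ξ‖ ^ 2 * (Q * C) := by gcongr
      _ = _ := by ring

theorem continuous_Aj (hβ : IsAdmissibleBump d β0) (hd : 2 ≤ d) {j : ℕ} {t : ℝ} (ht : 0 < t)
    {f : Ed d → ℂ} (hf : Integrable f) : Continuous (Aj d β0 j t f) := by
  obtain ⟨C, hC0, hC⟩ := hβ.exists_AjMult_bound hd
  refine continuous_multOp (B := √C) (R := 2 * 2 ^ j / t) (hβ.continuous_AjMult j t)
    (fun ξ => Real.le_sqrt_of_sq_le ?_) (fun ξ hξ => ?_) hf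
  · refine le_trans ?_ (hC j t ξ ht).1
    exact le_mul_of_one_le_left (sq_nonneg _) (one_le_pow₀ (one_le_pow₀ (by norm_num)))
  · rw [div_lt_iff₀ ht] at hξ
    exact (hβ.AjMult_eq_zero ht (.inr (by linarith))).1

theorem exists_lintegral_supAj_sq_le (hβ : IsAdmissibleBump d β0) (hd : 2 ≤ d) :
    ∃ C : ℝ, 0 < C ∧ ∀ (k : ℤ) (j : ℕ) (a : ℝ), (2 : ℝ) ^ (k - 1) ≤ a → ∀ h : Ed d → ℂ,
      Integrable h → MemLp h 2 →
      ∫⁻ x, supAj d β0 j (Icc a (a + 2 ^ (k - (j : ℤ)))) h x ^ 2 ≤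
        ENNReal.ofReal (C / (2 ^ j) ^ (d - 1)) * ∫⁻ x, ‖h x‖ₑ ^ 2 := by
  obtain ⟨C, hC0, hC⟩ := hβ.exists_AjMult_bound hd
  refine ⟨34 * C, by positivity, fun k j a ha h hh hh2 => ?_⟩
  set δ : ℝ := 2 ^ (k - (j : ℤ)) with hδ
  have hδ0 : 0 < δ := by positivity
  have hδj : δ * 2 ^ j = 2 * 2 ^ (k - 1) := by
    rw [hδ, ← zpow_natCast, ← zpow_add₀ two_ne_zero, ← zpow_one_add₀ two_ne_zero]; ring_nf
  have ha0 : 0 < (2 : ℝ) ^ (k - 1) := by positivity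
  have hpos : ∀ t ∈ Icc a (a + δ), 0 < t := fun t ht => by linarith [ht.1]
  have hvan : ∀ t ∈ Icc a (a + δ), ∀ ξ : Ed d, 4 / δ < ‖ξ‖ → 2 * 2 ^ j < t * ‖ξ‖ := by
    intro t ht ξ hξ
    rw [div_lt_iff₀ hδ0] at hξ
    have h1 : δ * 2 ^ j ≤ 2 * t := by rw [hδj]; linarith [ht.1]
    have hξ0 : 0 < ‖ξ‖ := by nlinarith [norm_nonneg ξ]
    have h2 : (0 : ℝ) < 2 ^ j := by positivity
    nlinarith
  set P : ℝ := (2 ^ j) ^ (d - 1)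
  have hP : 0 < P := by positivity
  have hmul : ∀ t ∈ Icc a (a + δ), ∀ ξ : Ed d, ‖AjMult β0 j t ξ‖ ≤ √(C / P) := fun t ht ξ => by
    refine Real.le_sqrt_of_sq_le ?_
    rw [le_div_iff₀ hP, mul_comm]
    exact (hC j t ξ (hpos t ht)).1
  have hder : ∀ t ∈ Icc a (a + δ), ∀ ξ : Ed d,
      ‖AjMultDeriv β0 j t ξ‖ ≤ √(C / P) * (4 / δ) := fun t ht ξ => by
    by_cases hξ : 4 / δ < ‖ξ‖
    · rw [(hβ.AjMult_eq_zero (hpos t ht) (.inr (hvan t ht ξ hξ))).2, norm_zero]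
      positivity
    · have : ‖AjMultDeriv β0 j t ξ‖ ≤ √(C / P * ‖ξ‖ ^ 2) := by
        refine Real.le_sqrt_of_sq_le ?_
        rw [div_mul_eq_mul_div, le_div_iff₀ hP, mul_comm]
        exact (hC j t ξ (hpos t ht)).2
      rw [Real.sqrt_mul (by positivity), Real.sqrt_sq (norm_nonneg _)] at this
      exact this.trans (mul_le_mul_of_nonneg_left (not_lt.1 hξ) (Real.sqrt_nonneg _))
  refine (lintegral_iSup_multOp_sq_le hδ0.le (hβ.continuous_AjMult j)
    (hβ.continuous_AjMultDeriv j) (hβ.hasDerivAt_AjMult j) hmul hder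
    (fun t ht ξ hξ => (hβ.AjMult_eq_zero (hpos t ht) (.inr (hvan t ht ξ hξ))).1)
    (fun t ht ξ hξ => (hβ.AjMult_eq_zero (hpos t ht) (.inr (hvan t ht ξ hξ))).2) hh hh2).trans_eq ?_
  congr 2
  have : δ * (√(C / P) * (4 / δ)) = 4 * √(C / P) := by field_simp
  rw [this, mul_pow, Real.sq_sqrt (by positivity)]
  ring

end IsAdmissibleBump

/-- The inverse Fourier transform of the annular profile. -/
def annulusKernel {d : ℕ} (β0 : Ed d → ℝ) (w : Ed d) : ℂ :=
  ∫ ξ : Ed d, eChar (2 * Real.pi * ⟪ξ, w⟫) * (annulusBump β0 ξ : ℂ)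

theorem integral_eChar_mul_annulusBump_smul {d : ℕ} (β0 : Ed d → ℝ) {s : ℝ} (hs : 0 < s)
    (w : Ed d) : ∫ ξ : Ed d, eChar (2 * Real.pi * ⟪ξ, w⟫) * (annulusBump β0 (s • ξ) : ℂ) =
      ((s ^ d)⁻¹ : ℝ) • annulusKernel β0 (s⁻¹ • w) := by
  have h := Measure.integral_comp_smul (volume : Measure (Ed d))
    (fun ξ => eChar (2 * Real.pi * ⟪ξ, s⁻¹ • w⟫) * (annulusBump β0 ξ : ℂ)) s
  rw [finrank_euclideanSpace_fin, abs_of_nonneg (by positivity)] at h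
  rw [annulusKernel, ← h]
  simp only [inner_smul_left, inner_smul_right, RCLike.conj_to_real,
    inv_mul_cancel_left₀ hs.ne']

theorem one_add_norm_rpow_neg_le {E : Type*} [NormedAddCommGroup E] [NormedSpace ℝ E] {N δ s : ℝ}
    {v w : E} (hN : 0 ≤ N) (hs0 : 0 < s) (hs : s ≤ 4 * δ) (hvw : ‖v‖ ≤ ‖w‖ + δ) :
    (1 + ‖s⁻¹ • w‖) ^ (-N) ≤ 2 ^ N * (1 + ‖(4 * δ)⁻¹ • v‖) ^ (-N) := by
  have hδ : 0 < 4 * δ := hs0.trans_le hs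
  have hδ' : δ ≠ 0 := by rintro rfl; simp at hδ
  have h1 : 1 + ‖(4 * δ)⁻¹ • v‖ ≤ 2 * (1 + ‖s⁻¹ • w‖) := by
    rw [norm_smul, norm_smul, norm_inv, norm_inv, Real.norm_of_nonneg hδ.le,
      Real.norm_of_nonneg hs0.le]
    have h2 : (4 * δ)⁻¹ * ‖w‖ ≤ s⁻¹ * ‖w‖ := by gcongr
    have h3 : (4 * δ)⁻¹ * ‖v‖ ≤ (4 * δ)⁻¹ * ‖w‖ + 1 / 4 := by
      calc _ ≤ (4 * δ)⁻¹ * (‖w‖ + δ) := by gcongr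
        _ = _ := by rw [mul_add]; congr 1; field_simp
    have : 0 ≤ s⁻¹ * ‖w‖ := by positivity
    linarith
  have h4 : (2 * (1 + ‖s⁻¹ • w‖)) ^ (-N) ≤ (1 + ‖(4 * δ)⁻¹ • v‖) ^ (-N) :=
    Real.rpow_le_rpow_of_nonpos (by positivity) h1 (by linarith)
  rw [Real.mul_rpow (by norm_num) (by positivity), Real.rpow_neg (by norm_num)] at h4
  have h5 : (0 : ℝ) < 2 ^ N := by positivity
  rwa [inv_mul_le_iff₀ h5] at h4

namespace IsAdmissibleBump

variable {d : ℕ} {β0 : Ed d → ℝ}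

theorem exists_annulusKernel_bound (hβ : IsAdmissibleBump d β0) :
    ∃ C, 0 < C ∧ ∀ w, ‖annulusKernel β0 w‖ ≤ C * (1 + ‖w‖) ^ (-(d + 1 : ℝ)) := by
  have hcs : HasCompactSupport fun ξ => (annulusBump β0 ξ : ℂ) :=
    hβ.hasCompactSupport_annulusBump.comp_left (g := fun r : ℝ => (r : ℂ)) Complex.ofReal_zero
  let S : SchwartzMap (Ed d) ℂ :=
    hcs.toSchwartzMap (Complex.ofRealCLM.contDiff.comp hβ.contDiff_annulusBump)
  have hS : annulusKernel β0 = FourierTransformInv.fourierInv S := by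
    rw [SchwartzMap.fourierInv_coe]
    ext w
    rw [Real.fourierInv_eq', annulusKernel]
    refine integral_congr_ae (.of_forall fun ξ => ?_)
    simp only [eChar, smul_eq_mul]
    rfl
  have h := SchwartzMap.one_add_le_sup_seminorm_apply (𝕜 := ℝ) (m := (d + 1, 0)) (k := d + 1)
    (n := 0) le_rfl le_rfl (FourierTransformInv.fourierInv S)
  simp only [norm_iteratedFDeriv_zero, ← hS] at h
  set C := (2 : ℝ) ^ (d + 1) * (Finset.Iic (d + 1, 0)).sup
    (fun m => SchwartzMap.seminorm ℝ m.1 m.2) (FourierTransformInv.fourierInv S)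
  refine ⟨|C| + 1, by positivity, fun w => ?_⟩
  have hw : (0 : ℝ) < 1 + ‖w‖ := by positivity
  have h2 : (1 + ‖w‖) ^ (d + 1 : ℝ) = (1 + ‖w‖) ^ (d + 1) := by exact_mod_cast Real.rpow_natCast _ _
  rw [Real.rpow_neg hw.le, ← div_eq_mul_inv, le_div_iff₀ (by positivity), mul_comm, h2]
  exact (h w).trans ((le_abs_self C).trans (le_add_of_nonneg_right zero_le_one))

theorem integrable_annulusBump_smul (hβ : IsAdmissibleBump d β0) {s : ℝ} (hs : s ≠ 0) :
    Integrable fun ξ => (annulusBump β0 (s • ξ) : ℂ) :=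
  ((hβ.contDiff_annulusBump.continuous.integrable_of_hasCompactSupport
    hβ.hasCompactSupport_annulusBump).ofReal (𝕜 := ℂ)).comp_smul hs

/-- `A_t^j` as convolution with the smoothed surface measure. -/
theorem Aj_eq_integral_kernel (hβ : IsAdmissibleBump d β0) {j : ℕ} {t s : ℝ} (hs0 : 0 < s)
    (hs : s = (2 ^ j)⁻¹ * t) {h : Ed d → ℂ} (hm : Measurable h) (hh : Integrable h) (x : Ed d) :
    Aj d β0 j t h x = ∫ q : sphere (0 : Ed d) 1 × Ed d,
      ((s ^ d)⁻¹ : ℝ) • annulusKernel β0 (s⁻¹ • (x - q.2 - t • (q.1 : Ed d))) * h q.2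
        ∂((sphereProb d).prod volume) := by
  have hbc := hβ.contDiff_annulusBump.continuous
  let F : Ed d → sphere (0 : Ed d) 1 × Ed d → ℂ := fun ξ q =>
    eChar (2 * Real.pi * ⟪ξ, x - q.2 - t • (q.1 : Ed d)⟫) * (annulusBump β0 (s • ξ) : ℂ) * h q.2
  have hF : Integrable (Function.uncurry F) (volume.prod ((sphereProb d).prod volume)) := by
    have hb := (hβ.integrable_annulusBump_smul hs0.ne').mul_prod
      ((integrable_const (1 : ℂ) (μ := sphereProb d)).mul_prod hh)
    refine hb.mono ?_ (.of_forall fun q => ?_)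
    · refine Measurable.aestronglyMeasurable ?_
      simp only [F, Function.uncurry_def]
      refine Measurable.mul (Continuous.measurable ?_) (by fun_prop)
      fun_prop
    · simp [F, Function.uncurry_def, norm_eChar]
  calc Aj d β0 j t h x = ∫ ξ, ∫ q, F ξ q ∂((sphereProb d).prod volume) := by
        refine integral_congr_ae (.of_forall fun ξ => ?_)
        simp only
        have h1 := integral_prod_mul (μ := sphereProb d) (ν := (volume : Measure (Ed d)))
          (fun y => eChar (-(2 * Real.pi * ⟪t • ξ, (y : Ed d)⟫)))
          (fun z => eChar (-(2 * Real.pi * ⟪ξ, z⟫)) * h z)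
        have h2 : (betaJ d β0 j (t • ξ) : ℂ) = annulusBump β0 (s • ξ) := by
          rw [betaJ_eq, smul_smul, hs]
        rw [h2, mul_right_comm (sigmaHat d _), sigmaHat, fourierInt, ← h1, ← mul_assoc,
          ← integral_const_mul, ← integral_mul_const]
        refine integral_congr_ae (.of_forall fun q => ?_)
        simp only [F]
        have h3 : 2 * Real.pi * ⟪ξ, x - q.2 - t • (q.1 : Ed d)⟫ = 2 * Real.pi * ⟪ξ, x⟫ +
            (-(2 * Real.pi * ⟪t • ξ, (q.1 : Ed d)⟫) + -(2 * Real.pi * ⟪ξ, q.2⟫)) := by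
          simp only [inner_sub_right, inner_smul_left, inner_smul_right, RCLike.conj_to_real]
          ring
        rw [h3, eChar_add, eChar_add]
        ring
    _ = ∫ q, (∫ ξ, F ξ q) ∂((sphereProb d).prod volume) := integral_integral_swap hF
    _ = _ := by
        refine integral_congr_ae (.of_forall fun q => ?_)
        simp only [F]
        rw [integral_mul_const, integral_eChar_mul_annulusBump_smul β0 hs0]

theorem exists_lintegral_supAj_le (hβ : IsAdmissibleBump d β0) :
    ∃ C : ℝ, 0 < C ∧ ∀ (k : ℤ) (j : ℕ) (a : ℝ), (2 : ℝ) ^ (k - 1) ≤ a →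
      a + (2 : ℝ) ^ (k - (j : ℤ)) ≤ 2 ^ (k + 2) → ∀ h : Ed d → ℂ, Measurable h → Integrable h →
      ∫⁻ x, supAj d β0 j (Icc a (a + 2 ^ (k - (j : ℤ)))) h x ≤
        ENNReal.ofReal C * ∫⁻ x, ‖h x‖ₑ := by
  obtain ⟨C, hC0, hC⟩ := hβ.exists_annulusKernel_bound
  set N : ℝ := d + 1 with hN
  have hN0 : 0 ≤ N := by positivity
  have hint : Integrable (fun w : Ed d => (1 + ‖w‖) ^ (-N)) :=
    integrable_one_add_norm (by rw [finrank_euclideanSpace_fin, hN]; linarith)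
  set J : ℝ := ∫ w : Ed d, (1 + ‖w‖) ^ (-N) with hJ
  have hJ0 : 0 ≤ J := integral_nonneg fun w => by positivity
  refine ⟨8 ^ d * C * 2 ^ N * J + 1, by positivity, fun k j a ha ha' h hm hh => ?_⟩
  set δ : ℝ := 2 ^ (k - (j : ℤ)) with hδ
  have hδ0 : 0 < δ := by positivity
  have e1 : (2 ^ j)⁻¹ * (2 : ℝ) ^ (k - 1) = δ / 2 := by
    rw [hδ, zpow_sub₀ two_ne_zero, zpow_sub₀ two_ne_zero, zpow_natCast, zpow_one]; ring
  have e2 : (2 ^ j)⁻¹ * (2 : ℝ) ^ (k + 2) = 4 * δ := by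
    rw [hδ, zpow_sub₀ two_ne_zero, zpow_add₀ two_ne_zero, zpow_natCast, zpow_ofNat]; ring
  let G : Ed d → ℝ := fun w => (2 / δ) ^ d * (C * 2 ^ N) * (1 + ‖(4 * δ)⁻¹ • w‖) ^ (-N)
  have hGm : Measurable G := by fun_prop
  have hG0 : ∀ w, 0 ≤ G w := fun w => by positivity
  have hGi : ∫⁻ w, ENNReal.ofReal (G w) = ENNReal.ofReal (8 ^ d * C * 2 ^ N * J) := by
    rw [← ofReal_integral_eq_lintegral_ofReal
      ((hint.comp_smul (inv_ne_zero (by positivity))).const_mul _) (.of_forall hG0)]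
    congr 1
    rw [integral_const_mul, Measure.integral_comp_smul volume (fun w : Ed d => (1 + ‖w‖) ^ (-N)),
      finrank_euclideanSpace_fin, ← hJ, abs_of_nonneg (by positivity), inv_pow, inv_inv,
      smul_eq_mul]
    have : (2 / δ) ^ d * (4 * δ) ^ d = 8 ^ d := by
      rw [← mul_pow]; congr 1; field_simp; norm_num
    linear_combination (C * 2 ^ N * J) * this
  have hpt : ∀ x, supAj d β0 j (Icc a (a + δ)) h x ≤ ∫⁻ q : sphere (0 : Ed d) 1 × Ed d,
      ENNReal.ofReal (G (x - q.2 - a • (q.1 : Ed d))) * ‖h q.2‖ₑ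
        ∂((sphereProb d).prod volume) := fun x => by
    refine iSup₂_le fun t ht => ?_
    have hs1 : δ / 2 ≤ (2 ^ j)⁻¹ * t := by
      rw [← e1]; gcongr; linarith [ht.1]
    have hs2 : (2 ^ j)⁻¹ * t ≤ 4 * δ := by
      rw [← e2]; gcongr; linarith [ht.2]
    set s := (2 ^ j)⁻¹ * t with hs
    have hs0 : 0 < s := by linarith
    change ‖Aj d β0 j t h x‖ₑ ≤ _
    rw [hβ.Aj_eq_integral_kernel hs0 hs hm hh]
    refine (enorm_integral_le_lintegral_enorm _).trans (lintegral_mono fun q => ?_)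
    rw [enorm_mul]
    gcongr
    rw [← ofReal_norm]
    refine ENNReal.ofReal_le_ofReal ?_
    rw [norm_smul, Real.norm_of_nonneg (by positivity)]
    have h1 : (s ^ d)⁻¹ ≤ (2 / δ) ^ d := by
      rw [← inv_pow]
      refine pow_le_pow_left₀ (by positivity) ?_ _
      rw [← inv_div]; gcongr
    have h2 : ‖x - q.2 - a • (q.1 : Ed d)‖ ≤ ‖x - q.2 - t • (q.1 : Ed d)‖ + δ := by
      have : x - q.2 - a • (q.1 : Ed d) = (x - q.2 - t • (q.1 : Ed d)) + (t - a) • (q.1 : Ed d) := by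
        rw [sub_smul]; abel
      rw [this]
      refine (norm_add_le _ _).trans (add_le_add_right ?_ _)
      rw [norm_smul, norm_eq_of_mem_sphere, mul_one, Real.norm_of_nonneg (by linarith [ht.1])]
      linarith [ht.2]
    calc _ ≤ (2 / δ) ^ d * (C * (2 ^ N * (1 + ‖(4 * δ)⁻¹ • (x - q.2 - a • (q.1 : Ed d))‖) ^ (-N))) := by
          gcongr
          exact (hC _).trans (mul_le_mul_of_nonneg_left
            (one_add_norm_rpow_neg_le hN0 hs0 hs2 h2) hC0.le)
      _ = _ := by simp only [G]; ring
  calc _ ≤ ∫⁻ x, ∫⁻ q : sphere (0 : Ed d) 1 × Ed d,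
      ENNReal.ofReal (G (x - q.2 - a • (q.1 : Ed d))) * ‖h q.2‖ₑ
        ∂((sphereProb d).prod volume) := lintegral_mono hpt
    _ = ∫⁻ q : sphere (0 : Ed d) 1 × Ed d, ∫⁻ x,
      ENNReal.ofReal (G (x - q.2 - a • (q.1 : Ed d))) * ‖h q.2‖ₑ
        ∂volume ∂((sphereProb d).prod volume) := by
        refine lintegral_lintegral_swap (Measurable.aemeasurable ?_)
        simp only [Function.uncurry_def]
        refine Measurable.mul (ENNReal.measurable_ofReal.comp (hGm.comp ?_)) (by fun_prop)
        exact Continuous.measurable (by fun_prop)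
    _ = ∫⁻ q : sphere (0 : Ed d) 1 × Ed d, ENNReal.ofReal (8 ^ d * C * 2 ^ N * J) * ‖h q.2‖ₑ
        ∂((sphereProb d).prod volume) := by
        refine lintegral_congr fun q => ?_
        rw [lintegral_mul_const' _ _ enorm_ne_top]
        simp only [sub_sub]
        rw [lintegral_sub_right_eq_self (fun w => ENNReal.ofReal (G w)), hGi]
    _ = ENNReal.ofReal (8 ^ d * C * 2 ^ N * J) * (sphereProb d univ * ∫⁻ x, ‖h x‖ₑ) := by
        rw [lintegral_const_mul _ (by fun_prop), lintegral_prod _ (by fun_prop)]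
        simp only [lintegral_const, mul_comm (sphereProb d univ)]
    _ ≤ ENNReal.ofReal (8 ^ d * C * 2 ^ N * J + 1) * (1 * ∫⁻ x, ‖h x‖ₑ) := by
        gcongr
        · linarith
        · exact sphereProb_univ_le d
    _ = _ := by rw [one_mul]

end IsAdmissibleBump

theorem lintegral_Ioi_ite_le_mul_rpow {γ p u : ℝ} (hγ : 0 < γ) (hp : 1 < p) (hu : 0 ≤ u) :
    ∫⁻ l in Ioi 0, (if γ * l ≤ u then ENNReal.ofReal u else 0) * ENNReal.ofReal (l ^ (p - 2)) =
      ENNReal.ofReal (γ ^ (1 - p) / (p - 1) * u ^ p) := by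
  have hug : 0 ≤ u / γ := by positivity
  have h1 : ∀ l : ℝ, (if γ * l ≤ u then ENNReal.ofReal u else 0) * ENNReal.ofReal (l ^ (p - 2)) =
      (Iic (u / γ)).indicator (fun l => ENNReal.ofReal u * ENNReal.ofReal (l ^ (p - 2))) l := by
    intro l
    have : γ * l ≤ u ↔ l ∈ Iic (u / γ) := by rw [mem_Iic, le_div_iff₀ hγ, mul_comm]
    simp only [this, indicator, ite_mul, zero_mul]
  simp only [h1]
  rw [setLIntegral_indicator measurableSet_Iic, Iic_inter_Ioi,
    lintegral_const_mul' _ _ ENNReal.ofReal_ne_top,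
    ← ofReal_integral_eq_lintegral_ofReal, ← intervalIntegral.integral_of_le hug,
    integral_rpow (.inl (by linarith)), ← ENNReal.ofReal_mul hu]
  · congr 1
    rw [show p - 2 + 1 = p - 1 by ring, Real.zero_rpow (by linarith), sub_zero,
      Real.div_rpow hu hγ.le, show 1 - p = -(p - 1) by ring, Real.rpow_neg hγ.le]
    rcases hu.eq_or_lt with rfl | hu
    · rw [Real.zero_rpow (by linarith), Real.zero_rpow (by linarith)]; simp
    · rw [Real.rpow_sub_one hu.ne']
      field_simp
  · exact (intervalIntegrable_iff_integrableOn_Ioc_of_le hug).1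
      (intervalIntegral.intervalIntegrable_rpow' (by linarith))
  · exact (ae_restrict_mem measurableSet_Ioc).mono fun l hl => Real.rpow_nonneg hl.1.le _

theorem lintegral_Ioi_ite_lt_mul_rpow {γ p u : ℝ} (hγ : 0 < γ) (hp : 1 < p) (hp2 : p < 2)
    (hu : 0 ≤ u) :
    ∫⁻ l in Ioi 0, (if γ * l ≤ u then 0 else ENNReal.ofReal (u ^ 2)) *
      ENNReal.ofReal (l ^ (p - 3)) = ENNReal.ofReal (γ ^ (2 - p) / (2 - p) * u ^ p) := by
  rcases hu.eq_or_lt with rfl | hu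
  · simp [Real.zero_rpow (by linarith : p ≠ 0)]
  have hug : 0 < u / γ := by positivity
  have h1 : ∀ l : ℝ, (if γ * l ≤ u then 0 else ENNReal.ofReal (u ^ 2)) *
      ENNReal.ofReal (l ^ (p - 3)) = (Ioi (u / γ)).indicator
        (fun l => ENNReal.ofReal (u ^ 2) * ENNReal.ofReal (l ^ (p - 3))) l := by
    intro l
    have : γ * l ≤ u ↔ l ∉ Ioi (u / γ) := by rw [mem_Ioi, not_lt, le_div_iff₀ hγ, mul_comm]
    simp only [this, indicator, ite_mul, zero_mul, ite_not]
  simp only [h1]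
  rw [setLIntegral_indicator measurableSet_Ioi, Ioi_inter_Ioi, max_eq_left hug.le,
    lintegral_const_mul' _ _ ENNReal.ofReal_ne_top,
    ← ofReal_integral_eq_lintegral_ofReal (integrableOn_Ioi_rpow_of_lt (by linarith) hug),
    integral_Ioi_rpow_of_lt (by linarith) hug, ← ENNReal.ofReal_mul (by positivity)]
  · congr 1
    rw [show p - 3 + 1 = -(2 - p) by ring, Real.div_rpow hu.le hγ.le, Real.rpow_neg hu.le,
      Real.rpow_neg hγ.le, Real.rpow_sub hu, Real.rpow_two]
    have : 2 - p ≠ 0 := by linarith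
    field_simp
  · exact (ae_restrict_mem measurableSet_Ioi).mono fun l hl =>
      Real.rpow_nonneg (hug.le.trans (le_of_lt hl)) _

/-- A truncated weak-type estimate interpolating between `L¹` and `L²` implies a strong type
estimate on `L^p`. -/
theorem lintegral_rpow_le_of_meas_lt_le {α : Type*} [MeasurableSpace α] {μ : Measure α} [SFinite μ]
    {F : α → ℝ≥0∞} {g : α → ℝ} {γ p a b : ℝ} (hF : Measurable F) (hFtop : ∀ᵐ x ∂μ, F x ≠ ∞)
    (hg : Measurable g) (hg0 : ∀ x, 0 ≤ g x) (hγ : 0 < γ) (hp : 1 < p) (hp2 : p < 2)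
    (ha : 0 ≤ a) (hb : 0 ≤ b)
    (hw : ∀ l : ℝ, 0 < l → μ {x | ENNReal.ofReal l < F x} ≤
      ENNReal.ofReal (a / l) * ∫⁻ x, (if γ * l ≤ g x then ENNReal.ofReal (g x) else 0) ∂μ +
      ENNReal.ofReal (b / l ^ 2) *
        ∫⁻ x, (if γ * l ≤ g x then 0 else ENNReal.ofReal (g x ^ 2)) ∂μ) :
    ∫⁻ x, F x ^ p ∂μ ≤
      ENNReal.ofReal (p * (a * (γ ^ (1 - p) / (p - 1)) + b * (γ ^ (2 - p) / (2 - p)))) *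
        ∫⁻ x, ENNReal.ofReal (g x ^ p) ∂μ := by
  have hp0 : 0 < p := by linarith
  have hS : MeasurableSet {q : ℝ × α | γ * q.1 ≤ g q.2} :=
    measurableSet_le (by fun_prop) (by fun_prop)
  let Φ : ℝ → α → ℝ≥0∞ := fun l x =>
    (if γ * l ≤ g x then ENNReal.ofReal (g x) else 0) * ENNReal.ofReal (l ^ (p - 2))
  let Ψ : ℝ → α → ℝ≥0∞ := fun l x =>
    (if γ * l ≤ g x then 0 else ENNReal.ofReal (g x ^ 2)) * ENNReal.ofReal (l ^ (p - 3))
  have hΦ : Measurable (Function.uncurry Φ) :=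
    (Measurable.ite hS (by fun_prop) (by fun_prop)).mul (by fun_prop)
  have hΨ : Measurable (Function.uncurry Ψ) :=
    (Measurable.ite hS (by fun_prop) (by fun_prop)).mul (by fun_prop)
  have hpt : ∀ l ∈ Ioi (0 : ℝ),
      μ {x | l < (F x).toReal} * ENNReal.ofReal (l ^ (p - 1)) ≤
        ENNReal.ofReal a * ∫⁻ x, Φ l x ∂μ + ENNReal.ofReal b * ∫⁻ x, Ψ l x ∂μ := by
    intro l (hl : 0 < l)
    have hsub : μ {x | l < (F x).toReal} ≤ μ {x | ENNReal.ofReal l < F x} :=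
      measure_mono fun x hx =>
        (ENNReal.ofReal_lt_ofReal_iff_of_nonneg hl.le).2 hx |>.trans_le ENNReal.ofReal_toReal_le
    refine (mul_le_mul_left (hsub.trans (hw l hl)) _).trans_eq ?_
    rw [add_mul, mul_right_comm, mul_right_comm (ENNReal.ofReal (b / l ^ 2)),
      ← ENNReal.ofReal_mul (by positivity), ← ENNReal.ofReal_mul (by positivity),
      lintegral_mul_const' _ _ ENNReal.ofReal_ne_top,
      lintegral_mul_const' _ _ ENNReal.ofReal_ne_top]
    have e1 : a / l * l ^ (p - 1) = a * l ^ (p - 2) := by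
      rw [show p - 2 = p - 1 - 1 by ring, Real.rpow_sub_one hl.ne' (p - 1)]; ring
    have e2 : b / l ^ 2 * l ^ (p - 1) = b * l ^ (p - 3) := by
      rw [show p - 3 = p - 1 - 2 by ring, Real.rpow_sub hl (p - 1), Real.rpow_two]; ring
    rw [e1, e2, ENNReal.ofReal_mul ha, ENNReal.ofReal_mul hb]
    ring
  calc ∫⁻ x, F x ^ p ∂μ = ∫⁻ x, ENNReal.ofReal ((F x).toReal ^ p) ∂μ := by
        refine lintegral_congr_ae (hFtop.mono fun x hx => ?_)
        simp only
        rw [← ENNReal.ofReal_rpow_of_nonneg ENNReal.toReal_nonneg hp0.le, ENNReal.ofReal_toReal hx]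
    _ = ENNReal.ofReal p * ∫⁻ l in Ioi 0,
        μ {x | l < (F x).toReal} * ENNReal.ofReal (l ^ (p - 1)) :=
        lintegral_rpow_eq_lintegral_meas_lt_mul μ (.of_forall fun _ => ENNReal.toReal_nonneg)
          hF.ennreal_toReal.aemeasurable hp0
    _ ≤ ENNReal.ofReal p * ∫⁻ l in Ioi 0,
        (ENNReal.ofReal a * ∫⁻ x, Φ l x ∂μ + ENNReal.ofReal b * ∫⁻ x, Ψ l x ∂μ) :=
        mul_le_mul_right (setLIntegral_mono' measurableSet_Ioi hpt) _
    _ = ENNReal.ofReal p * (ENNReal.ofReal a * (∫⁻ x, (∫⁻ l in Ioi 0, Φ l x) ∂μ) +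
        ENNReal.ofReal b * (∫⁻ x, (∫⁻ l in Ioi 0, Ψ l x) ∂μ)) := by
        have hΦi : Measurable fun l => ∫⁻ x, Φ l x ∂μ := hΦ.lintegral_prod_right'
        rw [lintegral_add_left (hΦi.const_mul _),
          lintegral_const_mul' _ _ ENNReal.ofReal_ne_top,
          lintegral_const_mul' _ _ ENNReal.ofReal_ne_top,
          lintegral_lintegral_swap hΦ.aemeasurable, lintegral_lintegral_swap hΨ.aemeasurable]
    _ = _ := by
        have hp1' : 0 < p - 1 := by linarith
        have hp2' : 0 < 2 - p := by linarith
        simp only [Φ, Ψ, lintegral_Ioi_ite_le_mul_rpow hγ hp (hg0 _),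
          lintegral_Ioi_ite_lt_mul_rpow hγ hp hp2 (hg0 _)]
        have hc1 : 0 ≤ γ ^ (1 - p) / (p - 1) := by positivity
        have hc2 : 0 ≤ γ ^ (2 - p) / (2 - p) := by positivity
        simp only [ENNReal.ofReal_mul hc1, ENNReal.ofReal_mul hc2]
        rw [lintegral_const_mul' _ _ ENNReal.ofReal_ne_top,
          lintegral_const_mul' _ _ ENNReal.ofReal_ne_top, ENNReal.ofReal_mul hp0.le,
          ENNReal.ofReal_add (by positivity) (by positivity), ENNReal.ofReal_mul ha,
          ENNReal.ofReal_mul hb]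
        ring

theorem fourierInt_add {d : ℕ} {f g : Ed d → ℂ} (hf : Integrable f) (hg : Integrable g) (ξ : Ed d) :
    fourierInt d (fun x => f x + g x) ξ = fourierInt d f ξ + fourierInt d g ξ := by
  have key {h : Ed d → ℂ} (hh : Integrable h) :
      Integrable fun x : Ed d => eChar (-(2 * Real.pi * ⟪ξ, x⟫)) * h x :=
    hh.bdd_mul (c := 1) (by fun_prop : Continuous _).aestronglyMeasurable
      (.of_forall fun x => (norm_eChar _).le)
  simp only [fourierInt, mul_add]
  exact integral_add (key hf) (key hg)

theorem multOp_add {d : ℕ} {m f g : Ed d → ℂ} {B R : ℝ} (hm : Continuous m)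
    (hB : ∀ ξ, ‖m ξ‖ ≤ B) (hR : ∀ ξ, R < ‖ξ‖ → m ξ = 0) (hf : Integrable f) (hg : Integrable g)
    (x : Ed d) : multOp m (fun y => f y + g y) x = multOp m f x + multOp m g x := by
  have key {h : Ed d → ℂ} (hh : Integrable h) :
      Integrable fun ξ : Ed d => eChar (2 * Real.pi * ⟪ξ, x⟫) * (m ξ * fourierInt d h ξ) :=
    (integrable_mult hm hB hR hh).bdd_mul (c := 1) (by fun_prop : Continuous _).aestronglyMeasurable
      (.of_forall fun ξ => (norm_eChar _).le)
  simp only [multOp, fourierInt_add hf hg, mul_add]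
  exact integral_add (key hf) (key hg)

theorem measure_ofReal_le_le_div {α : Type*} [MeasurableSpace α] {μ : Measure α} {F : α → ℝ≥0∞}
    (hF : Measurable F) {l A : ℝ} {K : ℝ≥0∞} (hl : 0 < l)
    (h : ∫⁻ x, F x ∂μ ≤ ENNReal.ofReal A * K) :
    μ {x | ENNReal.ofReal l ≤ F x} ≤ ENNReal.ofReal (A / l) * K := by
  refine (meas_ge_le_lintegral_div hF.aemeasurable (by simpa using hl) ENNReal.ofReal_ne_top).trans ?_
  rw [ENNReal.ofReal_div_of_pos hl, div_eq_mul_inv, div_eq_mul_inv, mul_right_comm]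
  gcongr

namespace IsAdmissibleBump

variable {d : ℕ} {β0 : Ed d → ℝ}

theorem Aj_add (hβ : IsAdmissibleBump d β0) (hd : 2 ≤ d) {j : ℕ} {t : ℝ} (ht : 0 < t)
    {f g : Ed d → ℂ} (hf : Integrable f) (hg : Integrable g) (x : Ed d) :
    Aj d β0 j t (fun y => f y + g y) x = Aj d β0 j t f x + Aj d β0 j t g x := by
  obtain ⟨C, -, hC⟩ := hβ.exists_AjMult_bound hd
  refine multOp_add (B := √C) (R := 2 * 2 ^ j / t) (hβ.continuous_AjMult j t)
    (fun ξ => Real.le_sqrt_of_sq_le ?_) (fun ξ hξ => ?_) hf hg x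
  · refine le_trans ?_ (hC j t ξ ht).1
    exact le_mul_of_one_le_left (sq_nonneg _) (one_le_pow₀ (one_le_pow₀ (by norm_num)))
  · rw [div_lt_iff₀ ht] at hξ
    exact (hβ.AjMult_eq_zero ht (.inr (by linarith))).1

theorem supAj_add_le (hβ : IsAdmissibleBump d β0) (hd : 2 ≤ d) {j : ℕ} {S : Set ℝ}
    (hS : ∀ t ∈ S, 0 < t) {f g : Ed d → ℂ} (hf : Integrable f) (hg : Integrable g) (x : Ed d) :
    supAj d β0 j S (fun y => f y + g y) x ≤ supAj d β0 j S f x + supAj d β0 j S g x := by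
  refine iSup₂_le fun t ht => ?_
  rw [hβ.Aj_add hd (hS t ht) hf hg]
  refine (enorm_add_le (Aj d β0 j t f x) (Aj d β0 j t g x)).trans (add_le_add ?_ ?_)
  · exact le_iSup₂ (f := fun t (_ : t ∈ S) => (‖Aj d β0 j t f x‖₊ : ℝ≥0∞)) t ht
  · exact le_iSup₂ (f := fun t (_ : t ∈ S) => (‖Aj d β0 j t g x‖₊ : ℝ≥0∞)) t ht

theorem measurable_supAj (hβ : IsAdmissibleBump d β0) (hd : 2 ≤ d) {j : ℕ} {S : Set ℝ}
    (hS : ∀ t ∈ S, 0 < t) {f : Ed d → ℂ} (hf : Integrable f) : Measurable (supAj d β0 j S f) :=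
  (lowerSemicontinuous_biSup fun t ht =>
    (hβ.continuous_Aj hd (hS t ht) hf).enorm.lowerSemicontinuous).measurable

/-- Marcinkiewicz interpolation between the bounds on `L¹` and `L²`. -/
theorem lintegral_supAj_rpow_le (hβ : IsAdmissibleBump d β0) (hd : 2 ≤ d) {j : ℕ} {S : Set ℝ}
    (hS : ∀ t ∈ S, 0 < t) {A B γ p : ℝ} (hA : 0 ≤ A) (hB : 0 ≤ B) (hγ : 0 < γ) (hp : 1 < p)
    (hp2 : p < 2)
    (h1 : ∀ h : Ed d → ℂ, Measurable h → Integrable h →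
      ∫⁻ x, supAj d β0 j S h x ≤ ENNReal.ofReal A * ∫⁻ x, ‖h x‖ₑ)
    (h2 : ∀ h : Ed d → ℂ, Integrable h → MemLp h 2 →
      ∫⁻ x, supAj d β0 j S h x ^ 2 ≤ ENNReal.ofReal B * ∫⁻ x, ‖h x‖ₑ ^ 2)
    {f : Ed d → ℂ} (hfm : Measurable f) (hf : Integrable f) (hf2 : MemLp f 2) :
    ∫⁻ x, supAj d β0 j S f x ^ p ≤
      ENNReal.ofReal (p * (2 * A * (γ ^ (1 - p) / (p - 1)) + 4 * B * (γ ^ (2 - p) / (2 - p)))) *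
        ∫⁻ x, ENNReal.ofReal (‖f x‖ ^ p) := by
  have hmeas := hβ.measurable_supAj hd (j := j) hS hf
  have hfin : ∀ᵐ x, supAj d β0 j S f x < ∞ := by
    refine ae_lt_top hmeas ((h1 f hfm hf).trans_lt ?_).ne
    exact ENNReal.mul_lt_top ENNReal.ofReal_lt_top hf.2
  refine lintegral_rpow_le_of_meas_lt_le hmeas (hfin.mono fun x hx => hx.ne) hfm.norm
    (fun x => norm_nonneg _) hγ hp hp2 (by positivity) (by positivity) fun l hl => ?_
  set E : Set (Ed d) := {x | γ * l ≤ ‖f x‖}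
  have hE : MeasurableSet E := measurableSet_le measurable_const hfm.norm
  have hi1 : Integrable (E.indicator f) := hf.indicator hE
  have hi2 : Integrable (Eᶜ.indicator f) := hf.indicator hE.compl
  have hsplit : f = fun x => E.indicator f x + Eᶜ.indicator f x :=
    (indicator_self_add_compl E f).symm
  have hsub : {x | ENNReal.ofReal l < supAj d β0 j S f x} ⊆
      {x | ENNReal.ofReal (l / 2) ≤ supAj d β0 j S (E.indicator f) x} ∪
      {x | ENNReal.ofReal ((l / 2) ^ 2) ≤ supAj d β0 j S (Eᶜ.indicator f) x ^ 2} := by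
    intro x hx
    by_contra hcon
    simp only [mem_union, mem_ofPred_eq, not_or, not_le] at hcon hx
    have h3 : supAj d β0 j S (Eᶜ.indicator f) x < ENNReal.ofReal (l / 2) := by
      rw [ENNReal.ofReal_pow (by positivity)] at hcon
      exact lt_of_pow_lt_pow_left' 2 hcon.2
    refine hx.not_ge ?_
    rw [hsplit, ← add_halves l, ENNReal.ofReal_add (by positivity) (by positivity)]
    exact (hβ.supAj_add_le hd hS hi1 hi2 x).trans (add_le_add hcon.1.le h3.le)
  refine (measure_mono hsub).trans ((measure_union_le _ _).trans (add_le_add ?_ ?_))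
  · refine (measure_ofReal_le_le_div (hβ.measurable_supAj hd hS hi1) (by positivity)
      (h1 _ (hfm.indicator hE) hi1)).trans_eq ?_
    congr 2
    · field_simp
    · ext x
      by_cases hx : γ * l ≤ ‖f x‖ <;> simp [E, hx, ofReal_norm]
  · refine (measure_ofReal_le_le_div ((hβ.measurable_supAj hd hS hi2).pow_const 2) (by positivity)
      (h2 _ hi2 (hf2.indicator hE.compl))).trans_eq ?_
    congr 2
    · field_simp; norm_num
    · ext x
      by_cases hx : γ * l ≤ ‖f x‖
      · simp [E, hx]
      · simp [E, hx, ENNReal.ofReal_pow, ofReal_norm]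

/-- The interpolated bound, with the constant uniform in the dyadic scales. -/
theorem exists_lintegral_supAj_rpow_le (hβ : IsAdmissibleBump d β0) (hd : 2 ≤ d) {p : ℝ}
    (hp1 : 1 ≤ p) (hp2 : p ≤ 2) :
    ∃ K : ℝ, 0 < K ∧ ∀ (k : ℤ) (j : ℕ) (a : ℝ), (2 : ℝ) ^ (k - 1) ≤ a →
      a + (2 : ℝ) ^ (k - (j : ℤ)) ≤ (2 : ℝ) ^ (k + 2) → ∀ f : Ed d → ℂ, Measurable f →
      Integrable f → MemLp f 2 →
      ∫⁻ x, supAj d β0 j (Icc a (a + 2 ^ (k - (j : ℤ)))) f x ^ p ≤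
        ENNReal.ofReal (K * ((2 ^ j) ^ (d - 1)) ^ (1 - p)) * ∫⁻ x, ‖f x‖ₑ ^ p := by
  obtain ⟨A, hA, h1⟩ := hβ.exists_lintegral_supAj_le
  obtain ⟨B, hB, h2⟩ := hβ.exists_lintegral_supAj_sq_le hd
  rcases hp1.eq_or_lt with rfl | hp1
  · refine ⟨A, hA, fun k j a hak hak' f hfm hf hf2 => ?_⟩
    simpa using h1 k j a hak hak' f hfm hf
  rcases hp2.eq_or_lt with rfl | hp2
  · refine ⟨B, hB, fun k j a hak hak' f hfm hf hf2 => ?_⟩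
    have h3 : (1 - 2 : ℝ) = -1 := by norm_num
    simpa [h3, Real.rpow_neg_one, div_eq_mul_inv] using h2 k j a hak f hf hf2
  have hp1' : 0 < p - 1 := by linarith
  have hp2' : 0 < 2 - p := by linarith
  refine ⟨p * (2 * A / (p - 1) + 4 * B / (2 - p)), by positivity,
    fun k j a hak hak' f hfm hf hf2 => ?_⟩
  have hP : (0 : ℝ) < (2 ^ j) ^ (d - 1) := by positivity
  have hS : ∀ t ∈ Icc a (a + (2 : ℝ) ^ (k - (j : ℤ))), 0 < t := fun t ht =>
    lt_of_lt_of_le (by positivity) (hak.trans ht.1)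
  refine (hβ.lintegral_supAj_rpow_le hd hS hA.le (div_pos hB hP).le hP hp1 hp2
    (h1 k j a hak hak') (h2 k j a hak) hfm hf hf2).trans_eq ?_
  congr 2
  · rw [show (2 - p) = (1 - p) + 1 by ring, Real.rpow_add_one hP.ne']
    field_simp
  · ext x
    rw [← ENNReal.ofReal_rpow_of_nonneg (norm_nonneg _) (by linarith), ofReal_norm]

end IsAdmissibleBump

/-- Lemma 2.1 (iii): for an interval `I ⊆ [2^{k-1}, 2^{k+2}]` of length `2^{k-j}`,
`‖sup_{t∈I}|A_t^j f|‖_p ≲ 2^{-j(d-1)/p'} ‖f‖_p`; here `1/p' = 1 - 1/p`. -/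
theorem Aj_sup_interval_Lp_bound (d : ℕ) (hd : 2 ≤ d) (β0 : Ed d → ℝ)
    (hβ0 : IsAdmissibleBump d β0) (p : ℝ) (hp1 : 1 ≤ p) (hp2 : p ≤ 2) :
    ∃ C : ℝ, 0 < C ∧ ∀ (k : ℤ) (j : ℕ), 10 ≤ j →
      ∀ a : ℝ, (2:ℝ) ^ (k - 1) ≤ a → a + (2:ℝ) ^ (k - (j:ℤ)) ≤ (2:ℝ) ^ (k + 2) →
      ∀ f : SchwartzMap (Ed d) ℂ,
        (∫⁻ x, (supAj d β0 j (Set.Icc a (a + (2:ℝ) ^ (k - (j:ℤ)))) (⇑f) x) ^ p) ^ (1 / p) ≤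
          ENNReal.ofReal (C * (2:ℝ) ^ (-(j:ℝ) * ((d:ℝ) - 1) * (1 - 1 / p))) *
            eLpNorm (⇑f) (ENNReal.ofReal p) volume := by
  obtain ⟨K, hK, h⟩ := hβ0.exists_lintegral_supAj_rpow_le hd hp1 hp2
  have hp : 0 < p := by linarith
  refine ⟨K ^ (1 / p), by positivity, fun k j _ a hak hak' f => ?_⟩
  have hconst : (K * (((2 : ℝ) ^ j) ^ (d - 1)) ^ (1 - p)) ^ (1 / p) =
      K ^ (1 / p) * 2 ^ (-(j : ℝ) * ((d : ℝ) - 1) * (1 - 1 / p)) := by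
    rw [Real.mul_rpow hK.le (by positivity), ← pow_mul, ← Real.rpow_natCast 2,
      ← Real.rpow_mul (by positivity), ← Real.rpow_mul (by positivity), Nat.cast_mul,
      Nat.cast_sub (by lia : 1 ≤ d), Nat.cast_one]
    congr 2
    field_simp
    ring
  rw [eLpNorm_eq_lintegral_rpow_enorm_toReal (by simpa using hp) ENNReal.ofReal_ne_top,
    ENNReal.toReal_ofReal hp.le, ← hconst,
    ← ENNReal.ofReal_rpow_of_nonneg (by positivity) (by positivity),
    ← ENNReal.mul_rpow_of_nonneg _ _ (by positivity)]
  gcongr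
  exact h k j a hak hak' f f.continuous.measurable f.integrable (f.memLp 2)
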